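/- arXiv:2002.01084 — 2 statements merged into one kernel-verified Lean document; each statement's English description precedes it below -/
import Mathlib

section
/- For every integer n ≥ 1 there exist a real-analytic, strictly decreasing, strictly convex function V : (0,∞) → (0,∞) with V ∈ D(n+1), constants 0 < c_k ≤ d_k < ∞ (k = 1,…,n−1) with c_k ≤ −y V^(k+1)(y)/V^(k)(y) ≤ d_k for all y > 0, and a probability space carrying a random variable Z with values in {1/2} ∪ {1, 2, 3, …}, each attained with positive probability, Z ≥ 1/2 a.s. and E[Z] = 1, such that the function v(y) := E[V(yZ)] is finite for every y > 0, is n-times differentiable on (0,∞) with 0 < (−1)^k v^(k)(y) = (−1)^k E[V^(k)(yZ) Z^k] < ∞ for k = 1,…,n and y > 0 (so v ∈ D(n)), yet lim_{y→1} (−1)^{n+1} (v^(n)(y) − v^(n)(1))/(y − 1) = +∞; in particular v is not (n+1)-times differentiable at y = 1. -/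
open MeasureTheory Filter Set Topology ENNReal

/-- Local complex-analytic extendability on the positive half-line. -/
def CAx (f : ℝ → ℝ) : Prop :=
  ∀ y > (0:ℝ), ∃ F : ℂ → ℂ, AnalyticAt ℂ F (y : ℂ) ∧ ∀ᶠ t : ℝ in 𝓝 y, (F (t : ℂ)).re = f t

lemma CAx.analyticOnNhd {f : ℝ → ℝ} (h : CAx f) : AnalyticOnNhd ℝ f (Set.Ioi 0) := by
  intro y hy
  obtain ⟨F, hF, he⟩ := h y hy
  exact hF.re_ofReal.congr he

lemma CAx.primitive {f G : ℝ → ℝ} (h : CAx f)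
    (hG : ∀ y > (0:ℝ), HasDerivAt G (-f y) y) : CAx G := by
  intro y hy
  obtain ⟨F, hF, he⟩ := h y hy
  obtain ⟨r, hr, hd⟩ := Metric.eventually_nhds_iff_ball.1 hF.eventually_analyticAt
  obtain ⟨r', hr', he'⟩ := Metric.eventually_nhds_iff_ball.1 he
  have hdo : DifferentiableOn ℂ F (Metric.ball (y:ℂ) r) :=
    fun z hz => (hd z hz).differentiableAt.differentiableWithinAt
  obtain ⟨H, hH⟩ := hdo.isExactOn_ball
  set ρ := min (min r r') y with hρ
  have hρ0 : 0 < ρ := lt_min (lt_min hr hr') hy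
  have hballC : ∀ t ∈ Metric.ball y ρ, (t : ℂ) ∈ Metric.ball (y:ℂ) r := by
    intro t ht
    rw [Metric.mem_ball] at ht ⊢
    rw [Complex.dist_eq, ← Complex.ofReal_sub, Complex.norm_real, ← dist_eq_norm]
    exact lt_of_lt_of_le ht ((min_le_left _ _).trans (min_le_left _ _))
  have hder : ∀ t ∈ Metric.ball y ρ,
      HasDerivAt (fun t : ℝ => G t + (H (t : ℂ)).re) 0 t := by
    intro t ht
    have h1 := (hH _ (hballC t ht)).real_of_complex
    have hfe : (F (t:ℂ)).re = f t := by
      apply he'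
      rw [Metric.mem_ball] at ht ⊢
      exact lt_of_lt_of_le ht ((min_le_left _ _).trans (min_le_right _ _))
    have ht0 : 0 < t := by
      rw [Metric.mem_ball, Real.dist_eq] at ht
      have := lt_of_lt_of_le ht (min_le_right _ _)
      have := (abs_lt.1 this).1
      linarith
    have := (hG t ht0).add h1
    rw [hfe] at this
    exact this.congr_deriv (by ring)
  have hconst : ∀ t ∈ Metric.ball y ρ, G t + (H (t : ℂ)).re = G y + (H (y : ℂ)).re := by
    intro t ht
    refine (convex_ball y ρ).is_const_of_fderivWithin_eq_zero (𝕜 := ℝ)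
      (f := fun t : ℝ => G t + (H (t : ℂ)).re) ?_ ?_ ht (Metric.mem_ball_self hρ0)
    · exact fun x hx => (hder x hx).differentiableAt.differentiableWithinAt
    · intro x hx
      have := (hder x hx).hasFDerivAt.hasFDerivWithinAt (s := Metric.ball y ρ)
      rw [this.fderivWithin (Metric.isOpen_ball.uniqueDiffWithinAt hx)]
      ext; simp
  refine ⟨fun z => ((G y + (H (y : ℂ)).re : ℝ) : ℂ) - H z, ?_, ?_⟩
  · refine analyticAt_const.sub ?_
    have : DifferentiableOn ℂ H (Metric.ball (y:ℂ) r) :=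
      fun z hz => (hH z hz).differentiableAt.differentiableWithinAt
    exact this.analyticAt (Metric.ball_mem_nhds _ hr)
  · filter_upwards [Metric.ball_mem_nhds y hρ0] with t ht
    have := hconst t ht
    rw [Complex.sub_re, Complex.ofReal_re]
    linarith

lemma CAx.continuousOn {f : ℝ → ℝ} (h : CAx f) : ContinuousOn f (Set.Ioi 0) :=
  h.analyticOnNhd.continuousOn

lemma integrable_inv_pow (k : ℕ) (hk : 1 ≤ k) (y : ℝ) (hy : 0 < y) (C : ℝ) :
    IntegrableOn (fun t : ℝ => C / t ^ (k+1)) (Set.Ioi y) ∧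
    ∫ t in Set.Ioi y, C / t ^ (k+1) = (C / k) / y ^ k := by
  have hk' : (1:ℝ) ≤ k := by exact_mod_cast hk
  have e : Set.EqOn (fun t : ℝ => C * t ^ (-((k:ℝ)+1))) (fun t : ℝ => C / t ^ (k+1)) (Set.Ioi y) := by
    intro t ht
    have ht0 : 0 < t := lt_trans hy ht
    simp only
    rw [Real.rpow_neg ht0.le, div_eq_mul_inv]
    congr 2
    exact_mod_cast Real.rpow_natCast t (k+1)
  constructor
  · refine IntegrableOn.congr_fun ?_ e measurableSet_Ioi
    exact (integrableOn_Ioi_rpow_of_lt (by linarith) hy).const_mul C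
  · rw [← setIntegral_congr_fun measurableSet_Ioi e, integral_const_mul,
      integral_Ioi_rpow_of_lt (by linarith) hy]
    have : -((k:ℝ)+1)+1 = -(k:ℝ) := by ring
    rw [this, Real.rpow_neg hy.le, Real.rpow_natCast]
    field_simp

lemma int_step (k : ℕ) (hk : 1 ≤ k) (g : ℝ → ℝ) (hg : CAx g) (c C : ℝ) (hc : 0 < c)
    (hb : ∀ y > (0:ℝ), c / y^(k+1) ≤ g y ∧ g y ≤ C / y^(k+1)) :
    ∃ G : ℝ → ℝ, CAx G ∧ (∀ y > (0:ℝ), HasDerivAt G (-g y) y) ∧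
      ∃ c' C' : ℝ, 0 < c' ∧ ∀ y > (0:ℝ), c' / y^k ≤ G y ∧ G y ≤ C' / y^k := by
  have hk' : (1:ℝ) ≤ k := by exact_mod_cast hk
  have hint : ∀ y > (0:ℝ), IntegrableOn g (Set.Ioi y) := by
    intro y hy
    refine Integrable.mono' (integrable_inv_pow k hk y hy C).1 ?_ ?_
    · exact (hg.continuousOn.mono (Set.Ioi_subset_Ioi hy.le)).aestronglyMeasurable measurableSet_Ioi
    · refine (ae_restrict_iff' measurableSet_Ioi).2 (ae_of_all _ fun t ht => ?_)
      have ht0 : 0 < t := lt_trans hy ht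
      have := hb t ht0
      have h2 : 0 < c / t^(k+1) := by positivity
      rw [Real.norm_of_nonneg (by linarith)]
      exact this.2
  have hder : ∀ y > (0:ℝ), HasDerivAt (fun y => ∫ t in Set.Ioi y, g t) (-g y) y := by
    intro y hy
    have hcont : ContinuousAt g y := hg.continuousOn.continuousAt (Ioi_mem_nhds hy)
    have h1 : HasDerivAt (fun u => ∫ t in y..u, g t) (g y) y := by
      refine intervalIntegral.integral_hasDerivAt_right (by simp) ?_ hcont
      exact hg.continuousOn.stronglyMeasurableAtFilter isOpen_Ioi y hy
    have h2 : HasDerivAt (fun u => (∫ t in Set.Ioi y, g t) - ∫ t in y..u, g t) (-g y) y := by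
      simpa using h1.const_sub (∫ t in Set.Ioi y, g t)
    refine h2.congr_of_eventuallyEq ?_
    filter_upwards [Ioi_mem_nhds hy] with u hu
    have := intervalIntegral.integral_Ioi_sub_Ioi' (hint y hy) (hint u hu)
    linarith
  refine ⟨_, hg.primitive hder, hder, c / k, C / k, by positivity, fun y hy => ?_⟩
  rw [← (integrable_inv_pow k hk y hy C).2, ← (integrable_inv_pow k hk y hy c).2]
  constructor
  · exact setIntegral_mono_on (integrable_inv_pow k hk y hy c).1 (hint y hy) measurableSet_Ioi
      fun t ht => (hb t (lt_trans hy ht)).1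
  · exact setIntegral_mono_on (hint y hy) (integrable_inv_pow k hk y hy C).1 measurableSet_Ioi
      fun t ht => (hb t (lt_trans hy ht)).2

lemma chain_exists (k : ℕ) : ∀ (g : ℝ → ℝ), CAx g → (∃ c C : ℝ, 0 < c ∧
    ∀ y > (0:ℝ), c / y^(k+1) ≤ g y ∧ g y ≤ C / y^(k+1)) →
    ∃ D : ℕ → ℝ → ℝ, D k = g ∧ CAx (D 0) ∧
      (∀ j < k, ∀ y > (0:ℝ), HasDerivAt (D j) (-D (j+1) y) y) ∧
      ∀ j ≤ k, ∃ c C : ℝ, 0 < c ∧ ∀ y > (0:ℝ), c / y^(j+1) ≤ D j y ∧ D j y ≤ C / y^(j+1) := by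
  induction k with
  | zero =>
    intro g hg hb
    refine ⟨fun _ => g, rfl, hg, fun j hj => absurd hj (Nat.not_lt_zero _), fun j hj => ?_⟩
    obtain rfl : j = 0 := by omega
    exact hb
  | succ k ih =>
    rintro g hg ⟨c, C, hc, hb⟩
    obtain ⟨G, hG, hd, hb'⟩ := int_step (k+1) (by omega) g hg c C hc hb
    obtain ⟨D, hDk, h0, hder, hbd⟩ := ih G hG hb'
    refine ⟨Function.update D (k+1) g, by simp, ?_, ?_, ?_⟩
    · rw [Function.update_of_ne (by omega)]; exact h0
    · intro j hj y hy
      rw [Function.update_of_ne (by omega)]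
      rcases Nat.lt_or_ge j k with h | h
      · rw [Function.update_of_ne (by omega)]; exact hder j h y hy
      · obtain rfl : j = k := by omega
        rw [Function.update_self, hDk]; exact hd y hy
    · intro j hj
      rcases Nat.lt_or_ge j (k+1) with h | h
      · rw [Function.update_of_ne (by omega)]; exact hbd j (by omega)
      · obtain rfl : j = k+1 := by omega
        rw [Function.update_self]; exact ⟨c, C, hc, hb⟩

noncomputable def wtC (z : ℂ) : ℂ :=
  1 + Complex.exp (-z) - Complex.exp (-(2 * Real.pi * Complex.I * z))

noncomputable def Sfun (t : ℝ) : ℝ := (Complex.log (wtC t)).im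

lemma wtC_re (t : ℝ) : (wtC t).re = 1 + Real.exp (-t) - Real.cos (2 * Real.pi * t) := by
  have : (wtC t) = 1 + ((Real.exp (-t) : ℝ):ℂ) -
     Complex.exp (((-(2*Real.pi*t) : ℝ):ℂ) * Complex.I) := by
    unfold wtC; push_cast; ring_nf
  rw [this, Complex.sub_re, Complex.exp_ofReal_mul_I_re, Complex.add_re, Complex.ofReal_re,
    Real.cos_neg]; simp

lemma wtC_im (t : ℝ) : (wtC t).im = Real.sin (2 * Real.pi * t) := by
  have : (wtC t) = 1 + ((Real.exp (-t) : ℝ):ℂ) -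
     Complex.exp (((-(2*Real.pi*t) : ℝ):ℂ) * Complex.I) := by
    unfold wtC; push_cast; ring_nf
  rw [this, Complex.sub_im, Complex.exp_ofReal_mul_I_im, Complex.add_im, Complex.ofReal_im,
    Real.sin_neg]; simp

lemma wtC_slit (t : ℝ) : wtC t ∈ Complex.slitPlane := by
  left
  rw [wtC_re]
  have := Real.cos_le_one (2 * Real.pi * t)
  have := Real.exp_pos (-t)
  linarith

lemma Sfun_abs (t : ℝ) : |Sfun t| ≤ 4 := by
  unfold Sfun
  rw [Complex.log_im]
  exact (Complex.abs_arg_le_pi _).trans Real.pi_le_four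

noncomputable def dS (t : ℝ) : ℝ :=
  (2 * Real.pi * (Real.cos (2 * Real.pi * t) * (1 + Real.exp (-t)) - 1)
      + Real.sin (2 * Real.pi * t) * Real.exp (-t)) /
   ((1 + Real.exp (-t) - Real.cos (2 * Real.pi * t))^2 + Real.sin (2 * Real.pi * t)^2)

lemma Sfun_deriv (t : ℝ) : HasDerivAt Sfun (dS t) t := by
  have hr : HasDerivAt (fun t : ℝ => 1 + Real.exp (-t) - Real.cos (2 * Real.pi * t))
     (-Real.exp (-t) + 2 * Real.pi * Real.sin (2 * Real.pi * t)) t := by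
    have h1 : HasDerivAt (fun t : ℝ => Real.exp (-t)) (Real.exp (-t) * (-1)) t :=
      (hasDerivAt_neg t).exp
    have h2 : HasDerivAt (fun t : ℝ => 2 * Real.pi * t) (2 * Real.pi) t := by
      simpa using (hasDerivAt_id t).const_mul (2 * Real.pi)
    exact ((h1.const_add 1).sub h2.cos).congr_deriv (by ring)
  have hi : HasDerivAt (fun t : ℝ => Real.sin (2 * Real.pi * t))
     (2 * Real.pi * Real.cos (2 * Real.pi * t)) t := by
    have h2 : HasDerivAt (fun t : ℝ => 2 * Real.pi * t) (2 * Real.pi) t := by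
      simpa using (hasDerivAt_id t).const_mul (2 * Real.pi)
    exact h2.sin.congr_deriv (by ring)
  have hw : HasDerivAt (fun t : ℝ => wtC t)
     (((-Real.exp (-t) + 2 * Real.pi * Real.sin (2 * Real.pi * t) : ℝ):ℂ) +
       ((2 * Real.pi * Real.cos (2 * Real.pi * t) : ℝ):ℂ) * Complex.I) t := by
    have := hr.ofReal_comp.add (hi.ofReal_comp.mul_const Complex.I)
    refine this.congr_of_eventuallyEq (Eventually.of_forall fun u => ?_)
    apply Complex.ext
    · simp only [wtC_re, Pi.add_apply, Complex.add_re, Complex.ofReal_re, Complex.re_ofReal_mul, Complex.I_re]; ring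
    · simp only [wtC_im, Pi.add_apply, Complex.add_im, Complex.ofReal_im, Complex.im_ofReal_mul, Complex.I_im]; ring
  have hl := hw.clog_real (wtC_slit t)
  have := Complex.imCLM.hasFDerivAt.comp_hasDerivAt t hl
  refine this.congr_deriv ?_
  rw [Complex.imCLM_apply]
  rw [Complex.div_im, Complex.normSq_apply, wtC_re, wtC_im]
  simp only [Complex.add_re, Complex.add_im, Complex.ofReal_re, Complex.ofReal_im, Complex.re_ofReal_mul, Complex.im_ofReal_mul, Complex.I_re, Complex.I_im]
  unfold dS
  rw [← sub_div]
  congr 1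
  · have := Real.sin_sq_add_cos_sq (2 * Real.pi * t)
    linear_combination (-(2 * Real.pi)) * this
  · ring

lemma dS_ge (t : ℝ) : -4 ≤ dS t := by
  unfold dS
  set s := Real.sin (2 * Real.pi * t)
  set c := Real.cos (2 * Real.pi * t)
  have hsc : s^2 + c^2 = 1 := Real.sin_sq_add_cos_sq _
  have hc1 : c ≤ 1 := Real.cos_le_one _
  have he := Real.exp_pos (-t)
  set e := Real.exp (-t)
  have hp := Real.pi_lt_d2
  have hp0 := Real.pi_gt_three
  have hD : 0 < (1 + e - c)^2 + s^2 := by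
    have : 0 < 1 + e - c := by linarith
    positivity
  rw [le_div_iff₀ hD]
  have k1 : 2 * (c * (1+e) - 1) ≥ - ((1 + e - c)^2 + s^2) := by nlinarith
  have k2 : (1 + e - c)^2 + s^2 ≥ - 2 * (s * e) := by nlinarith [sq_nonneg (s + e)]
  nlinarith

lemma dS_nat (m : ℕ) : dS m = 2 * Real.pi * Real.exp m := by
  unfold dS
  have h1 : Real.cos (2 * Real.pi * m) = 1 := by
    rw [mul_comm]; exact Real.cos_nat_mul_two_pi m
  have h2 : Real.sin (2 * Real.pi * m) = 0 := by
    have := Real.sin_nat_mul_pi (2*m)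
    rw [← this]; push_cast; ring_nf
  rw [h1, h2, Real.exp_neg]
  have := Real.exp_pos (m:ℝ)
  field_simp
  ring

noncomputable def gfun (n : ℕ) (y : ℝ) : ℝ := (10 - Sfun y / (1 + y)) / y^(n+1)

noncomputable def hfun (n : ℕ) (y : ℝ) : ℝ :=
  (n+1) * (10 - Sfun y / (1 + y)) / y^(n+2) + (dS y / (1+y) - Sfun y / (1+y)^2) / y^(n+1)

lemma S_div (y : ℝ) (hy : 0 < y) : |Sfun y / (1+y)| ≤ 4 := by
  rw [abs_div, abs_of_pos (by linarith : 0 < 1 + y), div_le_iff₀ (by linarith)]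
  nlinarith [Sfun_abs y]

lemma gfun_bd (n : ℕ) (y : ℝ) (hy : 0 < y) :
    6 / y^(n+1) ≤ gfun n y ∧ gfun n y ≤ 14 / y^(n+1) := by
  have := abs_le.1 (S_div y hy)
  unfold gfun
  constructor <;> gcongr <;> linarith

lemma gfun_deriv (n : ℕ) (y : ℝ) (hy : 0 < y) : HasDerivAt (gfun n) (-hfun n y) y := by
  have h1 : HasDerivAt (fun y : ℝ => 1 + y) 1 y := (hasDerivAt_id y).const_add 1
  have h2 := (((Sfun_deriv y).div h1 (by positivity)).const_sub 10).div (hasDerivAt_pow (n+1) y)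
    (by positivity)
  refine h2.congr_deriv ?_
  unfold hfun
  simp only [Pi.div_apply, Nat.add_sub_cancel]
  push_cast
  have : 1 + y ≠ 0 := by positivity
  field_simp
  ring

lemma hfun_ge (n : ℕ) (hn : 1 ≤ n) (y : ℝ) (hy : 0 < y) : 0 < hfun n y := by
  have hn' : (1:ℝ) ≤ n := by exact_mod_cast hn
  have h1 := abs_le.1 (S_div y hy)
  have h2 := dS_ge y
  have h3 := abs_le.1 (Sfun_abs y)
  have e : hfun n y = ((n+1) * (10 - Sfun y / (1 + y)) +
     y * (dS y / (1+y) - Sfun y / (1+y)^2)) / y^(n+2) := by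
    unfold hfun; field_simp; ring
  rw [e]
  apply div_pos _ (by positivity)
  have a : (-4) ≤ y * (dS y / (1+y)) := by
    rw [← mul_div_assoc, le_div_iff₀ (by positivity)]; nlinarith
  have b : y * (Sfun y / (1+y)^2) ≤ 4 := by
    rw [← mul_div_assoc, div_le_iff₀ (by positivity)]; nlinarith
  nlinarith

lemma hfun_nat (n m : ℕ) (hm : 1 ≤ m) :
    2 * Real.pi * Real.exp m / (1 + m) - 4 ≤ hfun n m * (m:ℝ)^(n+1) := by
  have hm0 : (0:ℝ) < m := by exact_mod_cast hm
  have h1 := abs_le.1 (S_div m hm0)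
  have h3 := abs_le.1 (Sfun_abs m)
  have e : hfun n m * (m:ℝ)^(n+1) = (n+1) * (10 - Sfun m / (1 + m)) / m
     + (dS m / (1+m) - Sfun m / (1+m)^2) := by
    unfold hfun; field_simp; ring
  rw [e, dS_nat]
  have a : 0 ≤ ((n:ℝ)+1) * (10 - Sfun m / (1 + m)) / m := by
    have : 0 ≤ 10 - Sfun m / (1 + m) := by linarith
    positivity
  have b : Sfun m / (1+m)^2 ≤ 4 := by
    rw [div_le_iff₀ (by positivity)]; nlinarith
  linarith

lemma unbounded_aux (M : ℝ) : ∃ m : ℕ, 1 ≤ m ∧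
    M < (1/3 * (1/2)^m) * (2 * Real.pi * Real.exp m / (1 + m) - 4) := by
  obtain ⟨m, hm⟩ := exists_nat_gt (max 1000 (50 * M + 1000))
  have hm1 : (1000:ℝ) < m := lt_of_le_of_lt (le_max_left _ _) hm
  have hm2 : 50 * M + 1000 < m := lt_of_le_of_lt (le_max_right _ _) hm
  refine ⟨m, by have : (1:ℝ) ≤ m := by linarith
                exact_mod_cast this, ?_⟩
  have hb : 1 + (m:ℝ) * (1/10) ≤ (1 + 1/10 : ℝ)^m :=
    one_add_mul_le_pow (by norm_num) m
  have he : ((1 + 1/10 : ℝ)^m)^2 * 2^m ≤ Real.exp m := by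
    have h1 : Real.exp m = (Real.exp 1)^m := by rw [← Real.exp_nat_mul, mul_one]
    rw [h1, ← pow_mul, mul_comm m 2, pow_mul, ← mul_pow]
    apply pow_le_pow_left₀ (by norm_num)
    have := Real.exp_one_gt_d9
    linarith
  have he2 : (1 + (m:ℝ) * (1/10))^2 * 2^m ≤ Real.exp m := by
    refine le_trans ?_ he
    gcongr
  have hp := Real.pi_gt_three
  have e1 : (1/2:ℝ)^m * 2^m = 1 := by rw [← mul_pow]; norm_num
  have e2 : (1/2:ℝ)^m ≤ 1 := pow_le_one₀ (by norm_num) (by norm_num)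
  have e0 : (0:ℝ) < (1/2:ℝ)^m := by positivity
  have h3 : (1 + (m:ℝ) * (1/10))^2 ≤ (1/2)^m * Real.exp m := by
    calc (1 + (m:ℝ) * (1/10))^2 = (1/2)^m * ((1 + (m:ℝ) * (1/10))^2 * 2^m) := by
          linear_combination (-(1 + (m:ℝ) * (1/10))^2) * e1
      _ ≤ _ := by gcongr
  have h4 : (1 + (m:ℝ) * (1/10)) / 10 ≤ (1/2)^m * Real.exp m / (1 + m) := by
    rw [le_div_iff₀ (by positivity)]
    nlinarith
  have h5 : (1/3 * (1/2)^m) * (2 * Real.pi * Real.exp m / (1 + m) - 4)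
     = 1/3 * (2 * Real.pi * ((1/2)^m * Real.exp m / (1 + m)) - 4 * (1/2)^m) := by ring
  rw [h5]
  have h6 : 6 * ((1 + (m:ℝ) * (1/10)) / 10) ≤ 2 * Real.pi * ((1/2)^m * Real.exp m / (1 + m)) := by
    apply mul_le_mul (by linarith) h4 (by positivity) (by positivity)
  nlinarith


lemma gfun_CAx (n : ℕ) : CAx (gfun n) := by
  intro y hy
  refine ⟨fun z => (10 - (-Complex.I * Complex.log (wtC z)) / (1 + z)) / z^(n+1), ?_, ?_⟩
  · have hyc : (y:ℂ) ≠ 0 := by exact_mod_cast hy.ne'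
    have hy1 : (1 + (y:ℂ)) ≠ 0 := by
      have : (1 + y : ℝ) ≠ 0 := by positivity
      exact_mod_cast this
    have hw : AnalyticAt ℂ wtC y := by
      unfold wtC
      fun_prop
    refine AnalyticAt.div ?_ (analyticAt_id.pow _) (pow_ne_zero _ hyc)
    refine analyticAt_const.sub (AnalyticAt.div ?_ (analyticAt_const.add analyticAt_id) hy1)
    exact analyticAt_const.mul (hw.clog (wtC_slit y))
  · refine Eventually.of_forall fun t => ?_
    have h1 : ((t:ℂ)^(n+1)) = ((t^(n+1) : ℝ) : ℂ) := by push_cast; rfl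
    have h2 : (1 + (t:ℂ)) = ((1 + t : ℝ) : ℂ) := by push_cast; rfl
    simp only [h1, h2]
    rw [Complex.div_ofReal_re, Complex.sub_re, Complex.div_ofReal_re]
    unfold gfun Sfun
    simp

/-! ### The random variable -/

noncomputable def wt (m : ℕ) : ℝ := if m = 0 then 2/3 else 1/3 * (1/2)^m

noncomputable def ZZ (m : ℕ) : ℝ := if m = 0 then 1/2 else m

noncomputable def PP : Measure ℕ := Measure.sum fun i => ENNReal.ofReal (wt i) • Measure.dirac i

lemma wt_pos (m : ℕ) : 0 < wt m := by
  unfold wt; split_ifs <;> positivity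

lemma wt_sum : HasSum wt 1 := by
  have h1 := (hasSum_geometric_of_lt_one (r := (1/2:ℝ)) (by norm_num) (by norm_num)).mul_left (1/3)
  have h2 := hasSum_ite_eq (0:ℕ) (1/3:ℝ)
  convert! h1.add h2 using 1
  · funext m
    unfold wt
    split_ifs with h
    · subst h; norm_num
    · ring
  · norm_num

instance PP_prob : IsProbabilityMeasure PP :=
  HasSum.isProbabilityMeasure_sum_dirac (fun i => (wt_pos i).le) wt_sum

lemma PP_singleton (m : ℕ) : PP {m} = ENNReal.ofReal (wt m) := by
  unfold PP
  rw [Measure.sum_smul_dirac_singleton]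

lemma ZZ_ge (m : ℕ) : 1/2 ≤ ZZ m := by
  unfold ZZ
  split_ifs with h
  · norm_num
  · have : (1:ℝ) ≤ m := by exact_mod_cast Nat.one_le_iff_ne_zero.2 h
    linarith

lemma ZZ_sum : HasSum (fun m => wt m * ZZ m) 1 := by
  have h1 := (hasSum_coe_mul_geometric_of_norm_lt_one (r := (1/2:ℝ))
    (by norm_num [abs_of_pos])).mul_left (1/3)
  have h2 := hasSum_ite_eq (0:ℕ) (1/3:ℝ)
  convert! h1.add h2 using 1
  · funext m
    unfold wt ZZ
    split_ifs with h
    · subst h; norm_num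
    · ring
  · norm_num

lemma ZZ_int : Integrable ZZ PP := by
  unfold PP
  rw [integrable_sum_dirac_iff (by simp)]
  convert! ZZ_sum.summable using 1
  funext m
  rw [ENNReal.toReal_ofReal (wt_pos m).le, Real.norm_of_nonneg (by linarith [ZZ_ge m])]

lemma ZZ_mean : ∫ ω, ZZ ω ∂PP = 1 := by
  have h := hasSum_integral_measure (f := ZZ) (μ := fun i : ℕ => ENNReal.ofReal (wt i) • Measure.dirac i) ZZ_int
  refine h.unique ?_
  convert! ZZ_sum using 1
  funext m
  rw [integral_smul_measure, integral_dirac, ENNReal.toReal_ofReal (wt_pos m).le, smul_eq_mul]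

lemma ZZ_pos (m : ℕ) : 0 < ZZ m := by linarith [ZZ_ge m]

lemma term_bound (k : ℕ) (f : ℝ → ℝ) (c C : ℝ) (hc : 0 < c)
    (hb : ∀ y > (0:ℝ), c / y^(k+1) ≤ f y ∧ f y ≤ C / y^(k+1)) (a y : ℝ) (ha : 0 < a) (hy : a ≤ y)
    (ω : ℕ) : 0 < f (y * ZZ ω) * ZZ ω ^ k ∧ f (y * ZZ ω) * ZZ ω ^ k ≤ 2 * C / a^(k+1) := by
  have hz := ZZ_pos ω
  have hz2 := ZZ_ge ω
  have hy0 : 0 < y := lt_of_lt_of_le ha hy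
  have hyz : 0 < y * ZZ ω := mul_pos hy0 hz
  obtain ⟨h1, h2⟩ := hb _ hyz
  have hpos : 0 < f (y * ZZ ω) := lt_of_lt_of_le (by positivity) h1
  have hC : 0 < C := by
    have h3 := lt_of_lt_of_le hpos h2
    by_contra h
    exact absurd (div_nonpos_of_nonpos_of_nonneg (not_lt.1 h) (by positivity : 0 ≤ (y * ZZ ω)^(k+1)))
      (not_le.2 h3)
  refine ⟨by positivity, ?_⟩
  calc f (y * ZZ ω) * ZZ ω ^ k ≤ C / (y * ZZ ω)^(k+1) * ZZ ω ^ k := by gcongr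
    _ = C / y^(k+1) * (1 / ZZ ω) := by rw [mul_pow, pow_succ (ZZ ω)]; field_simp
    _ ≤ C / a^(k+1) * 2 := by
        gcongr
        rw [div_le_iff₀ hz]; linarith
    _ = _ := by ring

lemma main_exists (n : ℕ) (hn : 1 ≤ n) : ∃ D : ℕ → ℝ → ℝ, D n = gfun n ∧ D (n+1) = hfun n ∧
    CAx (D 0) ∧ (∀ j < n + 1, ∀ y > (0:ℝ), HasDerivAt (D j) (-D (j+1) y) y) ∧
    (∀ j ≤ n, ∃ c C : ℝ, 0 < c ∧ ∀ y > (0:ℝ), c / y^(j+1) ≤ D j y ∧ D j y ≤ C / y^(j+1)) ∧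
    (∀ j ≤ n + 1, ∀ y > (0:ℝ), 0 < D j y) := by
  obtain ⟨D, h1, h2, h3, h4⟩ := chain_exists n (gfun n) (gfun_CAx n)
    ⟨6, 14, by norm_num, fun y hy => gfun_bd n y hy⟩
  refine ⟨Function.update D (n+1) (hfun n), ?_, by simp, ?_, ?_, ?_, ?_⟩
  · rw [Function.update_of_ne (by omega)]; exact h1
  · rw [Function.update_of_ne (by omega)]; exact h2
  · intro j hj y hy
    rw [Function.update_of_ne (by omega)]
    rcases Nat.lt_or_ge j n with h | h
    · rw [Function.update_of_ne (by omega)]; exact h3 j h y hy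
    · obtain rfl : j = n := by omega
      rw [Function.update_self, h1]; exact gfun_deriv j y hy
  · intro j hj
    rw [Function.update_of_ne (by omega)]; exact h4 j hj
  · intro j hj y hy
    rcases Nat.lt_or_ge j (n+1) with h | h
    · rw [Function.update_of_ne (by omega)]
      obtain ⟨c, C, hc, hb⟩ := h4 j (by omega)
      exact lt_of_lt_of_le (by positivity) (hb y hy).1
    · obtain rfl : j = n+1 := by omega
      rw [Function.update_self]; exact hfun_ge n hn y hy

lemma term_int (k : ℕ) (f : ℝ → ℝ) (h : ∃ c C : ℝ, 0 < c ∧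
    ∀ y > (0:ℝ), c / y^(k+1) ≤ f y ∧ f y ≤ C / y^(k+1)) (y : ℝ) (hy : 0 < y) :
    Integrable (fun ω => f (y * ZZ ω) * ZZ ω ^ k) PP := by
  obtain ⟨c, C, hc, hb⟩ := h
  refine Integrable.of_bound (C := 2 * C / y^(k+1)) (by fun_prop) (ae_of_all _ fun ω => ?_)
  have := term_bound k f c C hc hb y y hy le_rfl ω
  rw [Real.norm_of_nonneg this.1.le]
  exact this.2

lemma term_pos (k : ℕ) (f : ℝ → ℝ) (h : ∃ c C : ℝ, 0 < c ∧
    ∀ y > (0:ℝ), c / y^(k+1) ≤ f y ∧ f y ≤ C / y^(k+1)) (y : ℝ) (hy : 0 < y) :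
    0 < ∫ ω, f (y * ZZ ω) * ZZ ω ^ k ∂PP := by
  have hi := term_int k f h y hy
  obtain ⟨c, C, hc, hb⟩ := h
  have hp : ∀ ω, 0 < f (y * ZZ ω) * ZZ ω ^ k := fun ω =>
    (term_bound k f c C hc hb y y hy le_rfl ω).1
  rw [integral_pos_iff_support_of_nonneg (fun ω => (hp ω).le) hi]
  have : (Function.support fun ω => f (y * ZZ ω) * ZZ ω ^ k) = Set.univ := by
    ext ω; simpa using (hp ω).ne'
  rw [this]; simp

lemma term_le (k : ℕ) (f : ℝ → ℝ) (c C : ℝ) (hc : 0 < c)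
    (hb : ∀ y > (0:ℝ), c / y^(k+1) ≤ f y ∧ f y ≤ C / y^(k+1)) (y : ℝ) (hy : 0 < y) :
    ∫ ω, f (y * ZZ ω) * ZZ ω ^ k ∂PP ≤ 2 * C / y^(k+1) := by
  have := integral_mono (term_int k f ⟨c, C, hc, hb⟩ y hy) (integrable_const (2 * C / y^(k+1)))
    (fun ω => (term_bound k f c C hc hb y y hy le_rfl ω).2)
  simpa using this

lemma term_deriv (k : ℕ) (f f' : ℝ → ℝ) (h : ∃ c C : ℝ, 0 < c ∧
    ∀ y > (0:ℝ), c / y^(k+1) ≤ f y ∧ f y ≤ C / y^(k+1))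
    (h' : ∃ c C : ℝ, 0 < c ∧
    ∀ y > (0:ℝ), c / y^(k+1+1) ≤ f' y ∧ f' y ≤ C / y^(k+1+1))
    (hd : ∀ y > (0:ℝ), HasDerivAt f (-f' y) y) (y : ℝ) (hy : 0 < y) :
    HasDerivAt (fun y => ∫ ω, f (y * ZZ ω) * ZZ ω ^ k ∂PP)
      (-∫ ω, f' (y * ZZ ω) * ZZ ω ^ (k+1) ∂PP) y := by
  obtain ⟨c, C, hc, hb⟩ := h'
  rw [← integral_neg]
  refine (hasDerivAt_integral_of_dominated_loc_of_deriv_le (μ := PP)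
    (F := fun y ω => f (y * ZZ ω) * ZZ ω ^ k) (F' := fun y ω => -(f' (y * ZZ ω) * ZZ ω ^ (k+1)))
    (bound := fun _ => 2 * C / (y/2)^(k+1+1)) (s := Set.Ioi (y/2)) (Ioi_mem_nhds (by linarith))
    (Eventually.of_forall fun _ => by fun_prop) (term_int k f h y hy) (by fun_prop)
    (ae_of_all _ fun ω x hx => ?_) (integrable_const _) (ae_of_all _ fun ω x hx => ?_)).2
  · have := term_bound (k+1) f' c C hc hb (y/2) x (by linarith) (le_of_lt hx) ω
    rw [norm_neg, Real.norm_of_nonneg this.1.le]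
    exact this.2
  · have hx0 : 0 < x := lt_trans (by linarith) (hx : y/2 < x)
    have h1 : HasDerivAt (fun x : ℝ => x * ZZ ω) (ZZ ω) x := by
      simpa using (hasDerivAt_id x).mul_const (ZZ ω)
    have h2 := ((hd _ (mul_pos hx0 (ZZ_pos ω))).comp x h1).mul_const (ZZ ω ^ k)
    refine h2.congr_deriv ?_
    ring

lemma div_pow_tendsto (C : ℝ) : Tendsto (fun y : ℝ => C / y^(1+1)) atTop (𝓝 0) :=
  tendsto_const_nhds.div_atTop (tendsto_pow_atTop (by norm_num))

lemma blowup (n : ℕ) (hn : 1 ≤ n) :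
    Filter.Tendsto (fun y => -((∫ ω, gfun n (y * ZZ ω) * ZZ ω ^ n ∂PP) -
      ∫ ω, gfun n (1 * ZZ ω) * ZZ ω ^ n ∂PP) / (y - 1))
        (𝓝[≠] (1:ℝ)) Filter.atTop := by
  have hbd : ∃ c C : ℝ, 0 < c ∧
    ∀ y > (0:ℝ), c / y^(n+1) ≤ gfun n y ∧ gfun n y ≤ C / y^(n+1) :=
    ⟨6, 14, by norm_num, fun y hy => gfun_bd n y hy⟩
  have hanti : AntitoneOn (gfun n) (Set.Ioi 0) := by
    refine antitoneOn_of_deriv_nonpos (convex_Ioi 0) ?_ ?_ ?_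
    · exact fun x hx => (gfun_deriv n x hx).continuousAt.continuousWithinAt
    · rw [interior_Ioi]
      exact fun x hx => (gfun_deriv n x hx).differentiableAt.differentiableWithinAt
    · rw [interior_Ioi]
      intro x hx
      rw [(gfun_deriv n x hx).deriv]
      linarith [hfun_ge n hn x hx]
  rw [tendsto_atTop]
  intro M
  obtain ⟨m, hm, hM⟩ := unbounded_aux M
  have hm0 : (0:ℝ) < m := by exact_mod_cast hm
  have hZm : ZZ m = m := by unfold ZZ; rw [if_neg (by omega)]
  have hwm : wt m = 1/3 * (1/2)^m := by unfold wt; rw [if_neg (by omega)]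
  have hM' : M < wt m * (hfun n m * (m:ℝ)^(n+1)) := by
    refine lt_of_lt_of_le hM ?_
    rw [hwm]
    exact mul_le_mul_of_nonneg_left (hfun_nat n m hm) (by positivity)
  -- single-term slope
  have hsl : Tendsto (fun y : ℝ => wt m * (-(gfun n (y * m) * (m:ℝ)^n - gfun n (1 * m) * (m:ℝ)^n) / (y-1)))
      (𝓝[≠] (1:ℝ)) (𝓝 (wt m * (hfun n m * (m:ℝ)^(n+1)))) := by
    have h1 : HasDerivAt (fun x : ℝ => x * (m:ℝ)) (m:ℝ) 1 := by
      simpa using (hasDerivAt_id (1:ℝ)).mul_const (m:ℝ)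
    have h0 : HasDerivAt (gfun n) (-hfun n m) (1 * (m:ℝ)) := by
      rw [one_mul]; exact gfun_deriv n m hm0
    have h2 := ((h0.comp 1 h1).mul_const ((m:ℝ)^n)).neg
    have h3 := (hasDerivAt_iff_tendsto_slope.1 h2).const_mul (wt m)
    refine (h3.congr fun y => ?_).trans_eq ?_
    · rw [slope_def_field]
      simp only [Pi.neg_apply, Function.comp]
      ring
    · congr 1; ring
  have hpos : ∀ᶠ y : ℝ in 𝓝[≠] (1:ℝ), 0 < y :=
    nhdsWithin_le_nhds (Ioi_mem_nhds one_pos)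
  filter_upwards [hsl.eventually (lt_mem_nhds hM'), hpos, self_mem_nhdsWithin] with y hy hy0 hy1
  refine hy.le.trans ?_
  have i1 := term_int n _ hbd y hy0
  have i2 := term_int n _ hbd 1 one_pos
  set q : ℕ → ℝ := fun ω => -(gfun n (y * ZZ ω) * ZZ ω ^ n - gfun n (1 * ZZ ω) * ZZ ω ^ n) / (y-1) with hq
  have hqi : Integrable q PP := ((i1.sub i2).neg).div_const _
  have hqe : -((∫ ω, gfun n (y * ZZ ω) * ZZ ω ^ n ∂PP) -
      ∫ ω, gfun n (1 * ZZ ω) * ZZ ω ^ n ∂PP) / (y - 1) = ∫ ω, q ω ∂PP := by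
    rw [hq, integral_div, integral_neg, integral_sub i1 i2]
  rw [hqe]
  have hq0 : ∀ ω, 0 ≤ q ω := by
    intro ω
    have hz := ZZ_pos ω
    simp only [hq]
    have hzn : 0 ≤ ZZ ω ^ n := by positivity
    rcases lt_or_gt_of_ne (hy1 : y ≠ 1) with h | h
    · apply div_nonneg_of_nonpos _ (by linarith)
      have := hanti (show y * ZZ ω ∈ Set.Ioi 0 from mul_pos hy0 hz)
        (show 1 * ZZ ω ∈ Set.Ioi 0 from mul_pos one_pos hz) (by gcongr)
      nlinarith
    · apply div_nonneg _ (by linarith)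
      have := hanti (show 1 * ZZ ω ∈ Set.Ioi 0 from mul_pos one_pos hz)
        (show y * ZZ ω ∈ Set.Ioi 0 from mul_pos hy0 hz) (by gcongr)
      nlinarith
  have hs := setIntegral_le_integral (s := {m}) hqi (ae_of_all _ hq0)
  rw [integral_singleton, measureReal_def, PP_singleton, ENNReal.toReal_ofReal (wt_pos m).le,
    smul_eq_mul] at hs
  simpa [hq, hZm] using hs

/-- Counterexample 1.  For every `n ≥ 1` there exist a real-analytic,
strictly decreasing, strictly convex `V : (0,∞) → (0,∞)` in `𝒟(n+1)` (with derivative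
sequence `dV`), constants `0 < c_k ≤ d_k < ∞` (`k = 1,…,n−1`) bounding the ratios
`−y V^{(k+1)}(y)/V^{(k)}(y)`, and a probability space carrying a random variable `Z` with
values in `{1/2} ∪ {1,2,3,…}` (each attained with positive probability), `Z ≥ 1/2` a.s.
and `E[Z] = 1`, such that `v(y) := E[V(yZ)]` is finite for every `y > 0`, is `n`-times
differentiable on `(0,∞)` with `0 < (−1)^k v^{(k)}(y) = (−1)^k E[V^{(k)}(yZ) Z^k] < ∞`
for `k = 1,…,n` (so `v ∈ 𝒟(n)`), yet
`(−1)^{n+1}(v^{(n)}(y) − v^{(n)}(1))/(y−1) → +∞` as `y → 1`; in particular `v` is not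
`(n+1)`-times differentiable at `1`. -/
theorem stmt12 (n : ℕ) (hn : 1 ≤ n) :
    ∃ (V : ℝ → ℝ) (dV : ℕ → ℝ → ℝ) (c d : ℕ → ℝ)
      (Ω : Type) (_ : MeasurableSpace Ω) (P : Measure Ω) (Z : Ω → ℝ)
      (dv : ℕ → ℝ → ℝ),
      AnalyticOnNhd ℝ V (Set.Ioi 0) ∧
      StrictAntiOn V (Set.Ioi 0) ∧
      StrictConvexOn ℝ (Set.Ioi 0) V ∧
      (∀ y > (0:ℝ), 0 < V y) ∧
      dV 0 = V ∧
      (∀ k < n + 1, ∀ y > (0:ℝ), HasDerivAt (dV k) (dV (k + 1) y) y) ∧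
      (∀ k, 1 ≤ k → k ≤ n + 1 → ∀ y > (0:ℝ), 0 ≤ (-1 : ℝ) ^ k * dV k y) ∧
      Filter.Tendsto (dV 1) Filter.atTop (nhds 0) ∧
      (∀ k, 1 ≤ k → k ≤ n - 1 →
        0 < c k ∧ c k ≤ d k ∧
        ∀ y > (0:ℝ), c k ≤ -(y * dV (k + 1) y) / dV k y ∧
          -(y * dV (k + 1) y) / dV k y ≤ d k) ∧
      IsProbabilityMeasure P ∧ Measurable Z ∧
      (∀ ω, Z ω = 1 / 2 ∨ ∃ m : ℕ, 1 ≤ m ∧ Z ω = (m : ℝ)) ∧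
      0 < P {ω | Z ω = 1 / 2} ∧
      (∀ m : ℕ, 1 ≤ m → 0 < P {ω | Z ω = (m : ℝ)}) ∧
      (∀ᵐ ω ∂P, 1 / 2 ≤ Z ω) ∧
      MeasureTheory.Integrable Z P ∧ (∫ ω, Z ω ∂P) = 1 ∧
      (∀ y > (0:ℝ), MeasureTheory.Integrable (fun ω => V (y * Z ω)) P) ∧
      dv 0 = (fun y => ∫ ω, V (y * Z ω) ∂P) ∧
      (∀ k < n, ∀ y > (0:ℝ), HasDerivAt (dv k) (dv (k + 1) y) y) ∧
      (∀ k, 1 ≤ k → k ≤ n → ∀ y > (0:ℝ),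
        MeasureTheory.Integrable (fun ω => dV k (y * Z ω) * Z ω ^ k) P ∧
        dv k y = ∫ ω, dV k (y * Z ω) * Z ω ^ k ∂P ∧
        0 < (-1 : ℝ) ^ k * dv k y) ∧
      Filter.Tendsto (dv 1) Filter.atTop (nhds 0) ∧
      Filter.Tendsto (fun y => (-1 : ℝ) ^ (n + 1) * (dv n y - dv n 1) / (y - 1))
        (𝓝[≠] (1:ℝ)) Filter.atTop := by
  obtain ⟨D, hDn, hDn1, hCA, hder, hbd, hpos⟩ := main_exists n hn
  have hsgn : ∀ k : ℕ, ((-1:ℝ)^k) * (-1)^k = 1 := fun k => by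
    rw [← mul_pow]; norm_num
  have hder0 : ∀ y > (0:ℝ), HasDerivAt (D 0) (-D 1 y) y := fun y hy => hder 0 (by omega) y hy
  have hder1 : ∀ y > (0:ℝ), HasDerivAt (D 1) (-D 2 y) y := fun y hy => hder 1 (by omega) y hy
  have hcont0 : ContinuousOn (D 0) (Set.Ioi 0) :=
    fun x hx => (hder0 x hx).continuousAt.continuousWithinAt
  choose! c C hc hbd' using hbd
  have hbdE : ∀ j ≤ n, ∃ c C : ℝ, 0 < c ∧
      ∀ y > (0:ℝ), c / y^(j+1) ≤ D j y ∧ D j y ≤ C / y^(j+1) :=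
    fun j hj => ⟨c j, C j, hc j hj, hbd' j hj⟩
  have hcC : ∀ j ≤ n, c j ≤ C j := fun j hj => by
    have := hbd' j hj 1 one_pos
    simpa using this.1.trans this.2
  refine ⟨D 0, fun k y => (-1)^k * D k y, fun k => c (k+1) / C k, fun k => C (k+1) / c k,
    ℕ, inferInstance, PP, ZZ, fun k y => (-1)^k * ∫ ω, D k (y * ZZ ω) * ZZ ω ^ k ∂PP,
    hCA.analyticOnNhd, ?_, ?_, fun y hy => hpos 0 (by omega) y hy, by funext y; simp, ?_, ?_, ?_,
    ?_, PP_prob, measurable_of_countable _, ?_, ?_, ?_, ae_of_all _ ZZ_ge, ZZ_int, ZZ_mean,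
    ?_, ?_, ?_, ?_, ?_, ?_⟩
  · refine strictAntiOn_of_deriv_neg (convex_Ioi 0) hcont0 fun x hx => ?_
    rw [interior_Ioi] at hx
    rw [(hder0 x hx).deriv]
    linarith [hpos 1 (by omega) x hx]
  · refine StrictMonoOn.strictConvexOn_of_deriv (convex_Ioi 0) hcont0 ?_
    rw [interior_Ioi]
    have hm : StrictAntiOn (D 1) (Set.Ioi 0) := by
      refine strictAntiOn_of_deriv_neg (convex_Ioi 0)
        (fun x hx => (hder1 x hx).continuousAt.continuousWithinAt) fun x hx => ?_
      rw [interior_Ioi] at hx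
      rw [(hder1 x hx).deriv]
      linarith [hpos 2 (by omega) x hx]
    intro x hx y hy hxy
    rw [(hder0 x hx).deriv, (hder0 y hy).deriv]
    linarith [hm hx hy hxy]
  · intro k hk y hy
    refine ((hder k hk y hy).const_mul ((-1:ℝ)^k)).congr_deriv ?_
    simp only [pow_succ]; ring
  · intro k hk1 hk y hy
    rw [← mul_assoc, hsgn, one_mul]
    exact (hpos k hk y hy).le
  · have h1 : Tendsto (D 1) atTop (𝓝 0) := by
      refine tendsto_of_tendsto_of_tendsto_of_le_of_le' tendsto_const_nhds
        (div_pow_tendsto (C 1)) ?_ ?_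
      · filter_upwards [eventually_gt_atTop 0] with y hy
        exact (hpos 1 (by omega) y hy).le
      · filter_upwards [eventually_gt_atTop 0] with y hy
        exact (hbd' 1 hn y hy).2
    have h2 := h1.const_mul ((-1:ℝ)^1)
    rw [mul_zero] at h2
    exact h2
  · intro k hk1 hk
    have a1 := hc k (by omega)
    have a2 := hc (k+1) (by omega)
    have a3 := hcC k (by omega)
    have a4 := hcC (k+1) (by omega)
    refine ⟨div_pos a2 (by linarith), ?_, fun y hy => ?_⟩
    · exact div_le_div₀ (by linarith) a4 a1 a3
    have e : -(y * ((-1:ℝ)^(k+1) * D (k+1) y)) / ((-1)^k * D k y) = y * D (k+1) y / D k y := by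
      have h1 : (-1:ℝ)^k ≠ 0 := pow_ne_zero _ (by norm_num)
      rw [pow_succ, show -(y * ((-1:ℝ)^k * -1 * D (k+1) y)) = (-1)^k * (y * D (k+1) y) by ring,
        mul_div_mul_left _ _ h1]
    have p1 := hpos k (by omega) y hy
    obtain ⟨b1, b2⟩ := hbd' k (by omega) y hy
    obtain ⟨b3, b4⟩ := hbd' (k+1) (by omega) y hy
    have hyk : 0 < y^(k+1) := by positivity
    have hyk2 : 0 < y^(k+1+1) := by positivity
    rw [div_le_iff₀ (by positivity)] at b1 b3
    rw [le_div_iff₀ (by positivity)] at b2 b4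
    rw [pow_succ y (k+1)] at b3 b4
    simp only [e]
    constructor
    · rw [div_le_div_iff₀ (by linarith) p1]
      have hx1 : c (k+1) * (D k y * y^(k+1)) ≤ (D (k+1) y * (y^(k+1) * y)) * C k := by
        apply mul_le_mul b3 b2 (by positivity)
        have := hpos (k+1) (by omega) y hy
        positivity
      refine le_of_mul_le_mul_right ?_ hyk
      linarith
    · rw [div_le_div_iff₀ p1 a1]
      have hx1 : (D (k+1) y * (y^(k+1) * y)) * c k ≤ C (k+1) * (D k y * y^(k+1)) := by
        apply mul_le_mul b4 b1 a1.le (by linarith)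
      refine le_of_mul_le_mul_right ?_ hyk
      linarith
  · intro ω
    by_cases h : ω = 0
    · left; unfold ZZ; rw [if_pos h]
    · right; exact ⟨ω, by omega, by unfold ZZ; rw [if_neg h]⟩
  · refine lt_of_lt_of_le ?_ (measure_mono (μ := PP) (s := {0}) ?_)
    · rw [PP_singleton]; exact ENNReal.ofReal_pos.2 (wt_pos 0)
    · intro x hx
      rw [Set.mem_singleton_iff] at hx
      simp [hx, ZZ]
  · intro m hm
    refine lt_of_lt_of_le ?_ (measure_mono (μ := PP) (s := {m}) ?_)
    · rw [PP_singleton]; exact ENNReal.ofReal_pos.2 (wt_pos m)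
    · intro x hx
      rw [Set.mem_singleton_iff] at hx
      have : m ≠ 0 := by omega
      simp [hx, ZZ, this]
  · intro y hy
    simpa using term_int 0 (D 0) (hbdE 0 (by omega)) y hy
  · funext y; simp
  · intro k hk y hy
    have := (term_deriv k (D k) (D (k+1)) (hbdE k (by omega)) (hbdE (k+1) (by omega))
      (fun y hy => hder k (by omega) y hy) y hy).const_mul ((-1:ℝ)^k)
    refine this.congr_deriv ?_
    simp only [pow_succ]; ring
  · intro k hk1 hk y hy
    refine ⟨?_, ?_, ?_⟩
    · have := (term_int k (D k) (hbdE k hk) y hy).const_mul ((-1:ℝ)^k)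
      simpa only [mul_assoc] using this
    · simp only [mul_assoc]
      rw [integral_const_mul]
    · simp only
      rw [← mul_assoc, hsgn, one_mul]
      exact term_pos k (D k) (hbdE k hk) y hy
  · have h1 : Tendsto (fun y => ∫ ω, D 1 (y * ZZ ω) * ZZ ω ^ 1 ∂PP) atTop (𝓝 0) := by
      refine tendsto_of_tendsto_of_tendsto_of_le_of_le' tendsto_const_nhds
        (div_pow_tendsto (2 * C 1)) ?_ ?_
      · filter_upwards [eventually_gt_atTop 0] with y hy
        exact (term_pos 1 (D 1) (hbdE 1 hn) y hy).le
      · filter_upwards [eventually_gt_atTop 0] with y hy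
        exact term_le 1 (D 1) (c 1) (C 1) (hc 1 hn) (hbd' 1 hn) y hy
    have h2 := h1.const_mul ((-1:ℝ)^1)
    rw [mul_zero] at h2
    exact h2
  · refine (blowup n hn).congr fun y => ?_
    simp only [hDn]
    congr 1
    rw [pow_succ]
    linear_combination (-(∫ ω, gfun n (1 * ZZ ω) * ZZ ω ^ n ∂PP) +
      ∫ ω, gfun n (y * ZZ ω) * ZZ ω ^ n ∂PP) * hsgn n
end

section
/- Let U : (0,∞) → ℝ be strictly increasing, strictly concave, twice continuously differentiable, satisfying the Inada conditions lim_{x↓0} U′(x) = ∞ and lim_{x→∞} U′(x) = 0, and assume the relative risk aversion A(x) := −x U″(x)/U′(x) is not constant on (0,∞). Then there exist a probability space and a random variable S taking each value in {2} ∪ {1/n : n = 1, 2, 3, …} with positive probability, such that the value function u(x) := sup_{Δ ∈ [−x, x]} E[U(x + Δ(S − 1))], x > 0 (with the convention E[U(X)] := −∞ whenever E[U⁻(X)] = ∞), is finite for every x > 0 but fails to be twice differentiable at some point x₀ > 0. -/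
open MeasureTheory Filter Set Topology ENNReal

/-- Positive part of an extended real, in `[0,∞]`. -/
noncomputable def posPartE (x : EReal) : ℝ≥0∞ :=
  if x = ⊤ then ⊤ else ENNReal.ofReal x.toReal

/-- Negative part of an extended real, in `[0,∞]`. -/
noncomputable def negPartE (x : EReal) : ℝ≥0∞ :=
  if x = ⊥ then ⊤ else ENNReal.ofReal (-x.toReal)

/-- Expectation of an extended-real valued function, with the convention that it equals
`−∞` whenever the negative part has infinite integral. -/
noncomputable def expE {Ω : Type*} [MeasurableSpace Ω] (P : Measure Ω) (f : Ω → EReal) :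
    EReal :=
  ((∫⁻ ω, posPartE (f ω) ∂P : ℝ≥0∞) : EReal) - ((∫⁻ ω, negPartE (f ω) ∂P : ℝ≥0∞) : EReal)

/-- The extension of a utility `U : (0,∞) → ℝ` to `[0,∞)`, assigning to nonpositive
wealth the limiting utility `inf_{t>0} U(t) ∈ [−∞,∞)`. -/
noncomputable def extU (U : ℝ → ℝ) (w : ℝ) : EReal :=
  if 0 < w then ((U w : ℝ) : EReal) else ⨅ t : {t : ℝ // 0 < t}, ((U (t : ℝ) : ℝ) : EReal)

/-- The value function of optimal investment from initial capital `x` in the one-period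
market with riskless rate `0`, `S₀ = 1` and terminal stock price `S`: the terminal
wealths of admissible strategies are exactly `x + Δ(S−1)`, `Δ ∈ [−x, x]`. -/
noncomputable def valueFn {Ω : Type*} [MeasurableSpace Ω] (P : Measure Ω) (U : ℝ → ℝ)
    (S : Ω → ℝ) (x : ℝ) : EReal :=
  ⨆ Δ ∈ Set.Icc (-x) x, expE P (fun ω => extU U (x + Δ * (S ω - 1)))


lemma tangent_le {U U' : ℝ → ℝ} (hU' : ∀ x > (0:ℝ), HasDerivAt U (U' x) x)
    (hconc : ConcaveOn ℝ (Set.Ioi 0) U) {t y : ℝ} (ht : 0 < t) (hy : 0 < y) :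
    U t ≤ U y + U' y * (t - y) := by
  rcases lt_trichotomy t y with h | h | h
  · have := hconc.le_slope_of_hasDerivAt ht hy h (hU' y hy)
    rw [slope_def_field, le_div_iff₀ (by linarith)] at this
    linarith
  · subst h; simp
  · have := hconc.slope_le_of_hasDerivAt hy ht h (hU' y hy)
    rw [slope_def_field, div_le_iff₀ (by linarith)] at this
    linarith

lemma deriv_pos_of {U U' : ℝ → ℝ} (hU' : ∀ x > (0:ℝ), HasDerivAt U (U' x) x)
    (hmono : StrictMonoOn U (Set.Ioi 0))
    (hconc : ConcaveOn ℝ (Set.Ioi 0) U) {y : ℝ} (hy : 0 < y) : 0 < U' y := by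
  have h1 := tangent_le hU' hconc (t := y + 1) (y := y) (by linarith) hy
  have h2 := hmono (a := y) (b := y + 1) hy (by simp; linarith) (by linarith)
  linarith

/-- Peano second order expansion. -/
lemma peano2 {f f' : ℝ → ℝ} {c : ℝ} (hf : ∀ᶠ h in 𝓝 (0:ℝ), HasDerivAt f (f' h) h)
    (hf' : HasDerivAt f' c 0) :
    Tendsto (fun h => (f h - f 0 - h * f' 0) / h ^ 2) (𝓝[≠] 0) (𝓝 (c / 2)) := by
  have h0 : HasDerivAt f (f' 0) 0 := hf.self_of_nhds
  apply HasDerivAt.lhopital_zero_nhdsNE (f' := fun h => f' h - f' 0) (g' := fun h => 2 * h)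
  · apply eventually_nhdsWithin_of_eventually_nhds
    filter_upwards [hf] with h hh
    have := (hh.sub_const (f 0)).fun_sub ((hasDerivAt_id h).mul_const (f' 0))
    simpa using this
  · refine Eventually.of_forall fun h => ?_
    simpa using hasDerivAt_pow 2 h
  · filter_upwards [self_mem_nhdsWithin] with h hh
    simpa using hh
  · apply tendsto_nhdsWithin_of_tendsto_nhds
    have : ContinuousAt (fun h => f h - f 0 - h * f' 0) 0 :=
      (h0.continuousAt.sub continuousAt_const).sub (continuousAt_id.mul continuousAt_const)
    simpa [ContinuousAt] using this
  · apply tendsto_nhdsWithin_of_tendsto_nhds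
    have : ContinuousAt (fun h : ℝ => h ^ 2) 0 := by fun_prop
    simpa [ContinuousAt] using this
  · have h1 := (hasDerivAt_iff_tendsto_slope.1 hf').div_const 2
    refine h1.congr' ?_
    filter_upwards [self_mem_nhdsWithin] with h hh
    rw [slope_def_field]
    have : h ≠ 0 := hh
    field_simp
    simp

/-- choice of the weights -/
lemma weights (a b B : ℕ → ℝ) (n₀ : ℕ) (hB : ∀ n, 1 ≤ B n) (ha : ∀ n, |a n| ≤ B n)
    (hb : ∀ n, |b n| ≤ B n) (h0 : 0 < a 0) (h1 : a n₀ < 0)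
    (hne : b n₀ * a 0 ≠ b 0 * a n₀) :
    ∃ p : ℕ → ℝ, (∀ n, 0 < p n) ∧ HasSum p 1 ∧ Summable (fun n => p n * B n) ∧
      ∑' n, p n * a n = 0 ∧ ∑' n, p n * b n ≠ 0 := by
  set e : ℕ → ℝ := fun n => (1/2)^n / B n with he
  have epos : ∀ n, 0 < e n := fun n => by
    have := hB n
    simp only [he]; positivity
  have eB : ∀ n, e n * B n = (1/2)^n := fun n => by
    have := hB n
    simp only [he]; field_simp
  have sB : Summable (fun n => e n * B n) := by
    simp only [eB]; exact summable_geometric_two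
  have dom : ∀ c : ℕ → ℝ, (∀ n, |c n| ≤ B n) → Summable (fun n => e n * c n) := by
    intro c hc
    refine Summable.of_norm_bounded sB fun n => ?_
    rw [norm_mul, Real.norm_eq_abs, Real.norm_eq_abs, abs_of_pos (epos n)]
    exact mul_le_mul_of_nonneg_left (hc n) (epos n).le
  set A := ∑' n, e n * a n with hA
  set D := ∑' n, e n * b n with hD
  let q : ℝ → ℝ → ℕ → ℝ := fun α β n => e n + ((if n = 0 then α else 0) + if n = n₀ then β else 0)
  have hq : ∀ α β (c : ℕ → ℝ), Summable (fun n => e n * c n) →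
      HasSum (fun n => q α β n * c n) (∑' n, e n * c n + (α * c 0 + β * c n₀)) := by
    intro α β c hc
    have e1 : HasSum (fun n => if n = 0 then α * c 0 else 0) (α * c 0) := hasSum_ite_eq 0 _
    have e2 : HasSum (fun n => if n = n₀ then β * c n₀ else 0) (β * c n₀) := hasSum_ite_eq n₀ _
    refine (hc.hasSum.add (e1.add e2)).congr_fun ?_ 
    intro n
    simp only [q]
    by_cases h : n = 0 <;> by_cases h2 : n = n₀ <;> subst_vars <;> simp [*] <;> ring
  obtain ⟨β, hβ0, hβ1, hβ2⟩ : ∃ β : ℝ, 0 ≤ β ∧ A + β * a n₀ ≤ 0 ∧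
      D + (-(A + β * a n₀) / a 0 * b 0 + β * b n₀) ≠ 0 := by
    set β₀ := |A| / (-a n₀) with hβ₀
    have hn : 0 ≤ β₀ := div_nonneg (abs_nonneg _) (by linarith)
    have hz : β₀ * a n₀ = -|A| := by
      have := h1.ne
      rw [hβ₀]; field_simp
    have hAle := le_abs_self A
    by_cases h : D + (-(A + β₀ * a n₀) / a 0 * b 0 + β₀ * b n₀) = 0
    · refine ⟨β₀ + 1, by linarith, by nlinarith, fun h' => hne ?_⟩
      field_simp at h h'
      nlinarith
    · exact ⟨β₀, hn, by linarith, h⟩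
  set α := -(A + β * a n₀) / a 0 with hα
  have hα0 : 0 ≤ α := div_nonneg (by linarith) h0.le
  have qpos : ∀ n, 0 < q α β n := by
    intro n
    have := epos n
    simp only [q]
    have h1 : (0:ℝ) ≤ if n = 0 then α else 0 := by split_ifs <;> simp [hα0]
    have h2 : (0:ℝ) ≤ if n = n₀ then β else 0 := by split_ifs <;> simp [hβ0]
    linarith
  have s1 : Summable (q α β) := by
    have := (hq α β (fun _ => 1) (dom _ (fun n => by simpa using hB n))).summable
    simpa using this
  set Z := ∑' n, q α β n with hZ
  have Zpos : 0 < Z := s1.tsum_pos (fun n => (qpos n).le) 0 (qpos 0)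
  refine ⟨fun n => Z⁻¹ * q α β n, fun n => mul_pos (inv_pos.2 Zpos) (qpos n), ?_, ?_, ?_, ?_⟩
  · have := s1.hasSum.mul_left Z⁻¹
    rwa [← hZ, inv_mul_cancel₀ Zpos.ne'] at this
  · have := (hq α β B sB).summable.mul_left Z⁻¹
    simpa [mul_assoc] using this
  · have := (hq α β a (dom a ha)).mul_left Z⁻¹
    simp only [mul_assoc]
    rw [this.tsum_eq]
    rw [← hA, hα]
    field_simp
    simp
  · have := (hq α β b (dom b hb)).mul_left Z⁻¹
    simp only [mul_assoc]
    rw [this.tsum_eq]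
    exact mul_ne_zero (inv_ne_zero Zpos.ne') hβ2

/-- a function on `(0,∞)`, continuous, with `A (x/n) = A (2x)` for all `n ≥ 2`, is constant -/
lemma exists_ne_dilate (A : ℝ → ℝ) (hc : ContinuousOn A (Set.Ioi 0))
    (hne : ∃ x > (0:ℝ), ∃ y > (0:ℝ), A x ≠ A y) :
    ∃ x > (0:ℝ), ∃ n : ℕ, 2 ≤ n ∧ A (x / n) ≠ A (2 * x) := by
  by_contra! H
  have h1 : ∀ x > (0:ℝ), ∀ n : ℕ, 2 ≤ n → A (2 * n * x) = A x := by
    intro x hx n hn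
    have hn0 : (0:ℝ) < n := by positivity
    have := H (n * x) (by positivity) n hn
    rw [mul_div_cancel_left₀ _ hn0.ne'] at this
    rw [this]; ring_nf
  have h2 : ∀ x > (0:ℝ), A (2 * x) = A x := by
    intro x hx
    have e1 := h1 x hx 4 (by norm_num)
    have e2 := h1 (2 * x) (by linarith) 2 (by norm_num)
    rw [← e1, ← e2]; push_cast; ring_nf
  have h3 : ∀ n : ℕ, 1 ≤ n → ∀ x > (0:ℝ), A (n * x) = A x := by
    intro n hn x hx
    have hn0 : (0:ℝ) < n := by positivity
    rcases hn.eq_or_lt with h | h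
    · simp [← h]
    · rw [← h2 (n * x) (by positivity), ← mul_assoc, h1 x hx n h]
  have h4 : ∀ q : ℚ, 0 < q → A q = A 1 := by
    intro q hq
    have hnum : 0 < q.num := Rat.num_pos.2 hq
    have hq' : (0:ℝ) < q := by exact_mod_cast hq
    have e1 := h3 q.den q.den_pos q hq'
    have e2 := h3 q.num.toNat (by omega) 1 one_pos
    rw [← e1, ← e2]
    congr 1
    have : ((q.num.toNat : ℤ) : ℝ) = q.num := by
      rw [Int.toNat_of_nonneg hnum.le]
    have h5 : (q.num.toNat : ℝ) = q.num := by exact_mod_cast this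
    rw [h5, mul_one]
    exact_mod_cast Rat.den_mul_eq_num q
  have h5 : ∀ x > (0:ℝ), A x = A 1 := by
    intro x hx
    by_contra h
    have hev : ∀ᶠ y in 𝓝 x, A y ≠ A 1 ∧ 0 < y :=
      (((hc.continuousAt (Ioi_mem_nhds hx)).eventually_ne h)).and (Ioi_mem_nhds hx)
    obtain ⟨y, ⟨q, rfl⟩, hy1, hy2⟩ :=
      Rat.isDenseEmbedding_coe_real.dense.inter_nhds_nonempty hev
    exact hy1 (h4 q (by exact_mod_cast hy2))
  obtain ⟨x, hx, y, hy, hxy⟩ := hne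
  exact hxy ((h5 x hx).trans (h5 y hy).symm)

lemma posPartE_mono {x y : EReal} (h : x ≤ y) : posPartE x ≤ posPartE y := by
  induction x <;> induction y <;> simp_all [posPartE, ENNReal.ofReal_le_ofReal]

lemma negPartE_anti {x y : EReal} (h : x ≤ y) : negPartE y ≤ negPartE x := by
  induction x <;> induction y <;> simp_all [negPartE, ENNReal.ofReal_le_ofReal]

lemma expE_mono {Ω : Type*} [MeasurableSpace Ω] (P : Measure Ω) {f g : Ω → EReal}
    (h : ∀ ω, f ω ≤ g ω) : expE P f ≤ expE P g := by
  unfold expE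
  apply EReal.sub_le_sub
  · exact_mod_cast lintegral_mono fun ω => posPartE_mono (h ω)
  · exact_mod_cast lintegral_mono fun ω => negPartE_anti (h ω)

lemma expE_real {Ω : Type*} [MeasurableSpace Ω] (P : Measure Ω) {f : Ω → ℝ}
    (hf : Integrable f P) :
    expE P (fun ω => ((f ω : ℝ) : EReal)) = ((∫ ω, f ω ∂P : ℝ) : EReal) := by
  have h1 : ∫⁻ ω, ENNReal.ofReal (f ω) ∂P ≠ ⊤ := hf.lintegral_lt_top.ne
  have h2 : ∫⁻ ω, ENNReal.ofReal (-f ω) ∂P ≠ ⊤ := hf.neg.lintegral_lt_top.ne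
  rw [integral_eq_lintegral_pos_part_sub_lintegral_neg_part hf]
  simp only [expE, posPartE, negPartE, EReal.coe_ne_top, EReal.coe_ne_bot, if_false,
    EReal.toReal_coe]
  rw [EReal.coe_sub, EReal.coe_ennreal_toReal h1, EReal.coe_ennreal_toReal h2]

lemma extU_pos (U : ℝ → ℝ) {w : ℝ} (h : 0 < w) : extU U w = ((U w : ℝ) : EReal) := by
  simp [extU, h]

lemma extU_tangent {U U' : ℝ → ℝ} (hU' : ∀ x > (0:ℝ), HasDerivAt U (U' x) x)
    (hconc : ConcaveOn ℝ (Set.Ioi 0) U) {w y : ℝ} (hw : 0 ≤ w) (hy : 0 < y) :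
    extU U w ≤ ((U y + U' y * (w - y) : ℝ) : EReal) := by
  rcases hw.eq_or_lt with h | h
  · subst h
    have hT : Tendsto (fun t : ℝ => ((U y + U' y * (t - y) : ℝ) : EReal)) (𝓝[>] 0)
        (𝓝 ((U y + U' y * (0 - y) : ℝ) : EReal)) := by
      apply tendsto_nhdsWithin_of_tendsto_nhds
      have : Continuous (fun t : ℝ => ((U y + U' y * (t - y) : ℝ) : EReal)) :=
        continuous_coe_real_ereal.comp (by fun_prop)
      exact this.tendsto 0
    refine ge_of_tendsto hT ?_
    filter_upwards [self_mem_nhdsWithin] with t ht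
    have ht' : (0:ℝ) < t := ht
    simp only [extU, lt_irrefl, if_false]
    refine (iInf_le _ ⟨t, ht'⟩).trans ?_
    exact_mod_cast tangent_le hU' hconc ht' hy
  · rw [extU_pos U h]
    exact_mod_cast tangent_le hU' hconc h hy

lemma extU_le {U : ℝ → ℝ} (hmono : StrictMonoOn U (Set.Ioi 0)) {w y : ℝ} (hwy : w ≤ y)
    (hy : 0 < y) : extU U w ≤ ((U y : ℝ) : EReal) := by
  by_cases h : 0 < w
  · rw [extU_pos U h]
    exact_mod_cast hmono.monotoneOn h hy hwy
  · simp only [extU, h, if_false]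
    exact iInf_le (fun t : {t : ℝ // 0 < t} => ((U (t : ℝ) : ℝ) : EReal)) ⟨y, hy⟩

lemma value_finite {U : ℝ → ℝ} (hmono : StrictMonoOn U (Set.Ioi 0)) (P : Measure ℕ)
    [IsProbabilityMeasure P] (S : ℕ → ℝ) (hS : ∀ n, S n = 2 ∨ (0 < S n ∧ S n ≤ 1))
    {x : ℝ} (hx : 0 < x) : valueFn P U S x ≠ ⊥ ∧ valueFn P U S x ≠ ⊤ := by
  constructor
  · have : ((U x : ℝ) : EReal) ≤ valueFn P U S x := by
      unfold valueFn
      refine le_trans ?_ (le_iSup₂ (0:ℝ) (by constructor <;> linarith))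
      simp only [zero_mul, add_zero, extU_pos U hx]
      rw [expE_real P (integrable_const _)]
      simp
    exact ne_bot_of_le_ne_bot (EReal.coe_ne_bot _) this
  · have : valueFn P U S x ≤ ((U (2 * x) : ℝ) : EReal) := by
      unfold valueFn
      refine iSup₂_le fun Δ hΔ => ?_
      have : expE P (fun n => extU U (x + Δ * (S n - 1))) ≤
          expE P (fun n => ((U (2 * x) : ℝ) : EReal)) := by
        refine expE_mono P fun n => extU_le hmono ?_ (by linarith)
        obtain ⟨h1, h2⟩ := hΔ
        rcases hS n with h | ⟨h, h'⟩
        · rw [h]; linarith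
        · nlinarith
      refine this.trans ?_
      rw [expE_real P (integrable_const _)]
      simp
    exact ne_top_of_le_ne_top (EReal.coe_ne_top _) this

lemma taylor_bound {U U' U'' : ℝ → ℝ} (hU' : ∀ x > (0:ℝ), HasDerivAt U (U' x) x)
    (hU'' : ∀ x > (0:ℝ), HasDerivAt U' (U'' x) x) {lo hi M y k : ℝ} (hlo : 0 < lo)
    (hM : ∀ z ∈ Set.Icc lo hi, |U'' z| ≤ M) (hy : y ∈ Set.Icc lo hi)
    (hk : y + k ∈ Set.Icc lo hi) : |U (y + k) - U y - k * U' y| ≤ M * k ^ 2 := by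
  have hM0 : 0 ≤ M := (abs_nonneg _).trans (hM y hy)
  have hsub : Set.uIcc y (y + k) ⊆ Set.Icc lo hi := Set.uIcc_subset_Icc hy hk
  have h1 : ∀ z ∈ Set.uIcc y (y + k), |U' z - U' y| ≤ M * |z - y| := by
    intro z hz
    have := (convex_Icc lo hi).norm_image_sub_le_of_norm_hasDerivWithin_le (f := U') (f' := U'')
      (C := M) (fun t ht => (hU'' t (hlo.trans_le ht.1)).hasDerivWithinAt)
      (fun t ht => hM t ht) hy (hsub hz)
    simpa using this
  have h2 := (convex_uIcc y (y + k)).norm_image_sub_le_of_norm_hasDerivWithin_le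
    (f := fun z => U z - z * U' y) (f' := fun z => U' z - U' y) (C := M * |k|)
    (fun t ht => by
      have := (hU' t (hlo.trans_le (hsub ht).1)).fun_sub ((hasDerivAt_id t).mul_const (U' y))
      simpa using this.hasDerivWithinAt)
    (fun t ht => by
      refine (h1 t ht).trans (mul_le_mul_of_nonneg_left ?_ hM0)
      have := Set.abs_sub_left_of_mem_uIcc ht
      simpa using this)
    Set.left_mem_uIcc Set.right_mem_uIcc
  simp only [Real.norm_eq_abs, add_sub_cancel_left] at h2
  calc _ = |U (y + k) - (y + k) * U' y - (U y - y * U' y)| := by congr 1; ring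
    _ ≤ _ := h2
    _ = M * k ^ 2 := by rw [mul_assoc, ← sq, sq_abs]

structure Dat (U U' U'' : ℝ → ℝ) (P : Measure ℕ) (S B : ℕ → ℝ) (x₀ : ℝ) : Prop where
  hU' : ∀ x > (0:ℝ), HasDerivAt U (U' x) x
  hU'' : ∀ x > (0:ℝ), HasDerivAt U' (U'' x) x
  hconc : ConcaveOn ℝ (Set.Ioi 0) U
  hS : ∀ n, S n = 2 ∨ (0 < S n ∧ S n ≤ 1)
  hx₀ : 0 < x₀
  hB : ∀ n, ∀ z ∈ Set.Icc (x₀ * S n / 2) (4 * x₀), |U z| ≤ B n ∧ |U' z| ≤ B n ∧ |U'' z| ≤ B n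
  hBi : Integrable B P

namespace Dat

variable {U U' U'' : ℝ → ℝ} {P : Measure ℕ} {S B : ℕ → ℝ} {x₀ : ℝ}

lemma Spos (d : Dat U U' U'' P S B x₀) (n : ℕ) : 0 < S n := by
  rcases d.hS n with h | h
  · rw [h]; norm_num
  · exact h.1

lemma Sle (d : Dat U U' U'' P S B x₀) (n : ℕ) : S n ≤ 2 := by
  rcases d.hS n with h | h
  · rw [h]
  · linarith [h.2]

lemma Sabs (d : Dat U U' U'' P S B x₀) (n : ℕ) : |S n| ≤ 2 := by
  rw [abs_of_pos (d.Spos n)]; exact d.Sle n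

lemma Sabs1 (d : Dat U U' U'' P S B x₀) (n : ℕ) : |S n - 1| ≤ 1 := by
  have := d.Spos n
  have := d.Sle n
  rw [abs_le]; constructor <;> linarith

lemma mem_K (d : Dat U U' U'' P S B x₀) {x : ℝ} (h1 : x₀ / 2 ≤ x) (h2 : x ≤ 2 * x₀) (n : ℕ) :
    x * S n ∈ Set.Icc (x₀ * S n / 2) (4 * x₀) := by
  have := d.Spos n
  have := d.Sle n
  have := d.hx₀
  constructor <;> nlinarith

lemma mem_K0 (d : Dat U U' U'' P S B x₀) (n : ℕ) :
    x₀ * S n ∈ Set.Icc (x₀ * S n / 2) (4 * x₀) :=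
  d.mem_K (by linarith [d.hx₀]) (by linarith [d.hx₀]) n

lemma lo_pos (d : Dat U U' U'' P S B x₀) (n : ℕ) : 0 < x₀ * S n / 2 := by
  have := d.Spos n
  have := d.hx₀
  positivity

lemma int_of (d : Dat U U' U'' P S B x₀) {f : ℕ → ℝ} (C : ℝ) (hf : ∀ n, |f n| ≤ C * B n) :
    Integrable f P :=
  (d.hBi.const_mul C).mono' (Measurable.of_discrete).aestronglyMeasurable
    (Eventually.of_forall hf)

lemma int_mul (d : Dat U U' U'' P S B x₀) {f b : ℕ → ℝ} (C : ℝ) (hf : ∀ n, |f n| ≤ B n)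
    (hb : ∀ n, |b n| ≤ C) : Integrable (fun n => f n * b n) P := by
  refine d.int_of C fun n => ?_
  rw [abs_mul, mul_comm]
  exact mul_le_mul (hb n) (hf n) (abs_nonneg _) ((abs_nonneg _).trans (hb n))

lemma int_one (d : Dat U U' U'' P S B x₀) {f : ℕ → ℝ} (hf : ∀ n, |f n| ≤ B n) :
    Integrable f P := d.int_of 1 (by simpa using hf)

/-- on the binding side, the optimal strategy is `Δ = x` -/
lemma binding (d : Dat U U' U'' P S B x₀) {x : ℝ} (h1 : x₀ / 2 ≤ x) (h2 : x ≤ 2 * x₀)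
    (hg : 0 ≤ ∫ n, U' (x * S n) * (S n - 1) ∂P) :
    valueFn P U S x = ((∫ n, U (x * S n) ∂P : ℝ) : EReal) := by
  have hx : 0 < x := by linarith [d.hx₀]
  have hxS : ∀ n, 0 < x * S n := fun n => mul_pos hx (d.Spos n)
  have i1 : Integrable (fun n => U (x * S n)) P :=
    d.int_one fun n => (d.hB n _ (d.mem_K h1 h2 n)).1
  have i2 : Integrable (fun n => U' (x * S n) * (S n - 1)) P :=
    d.int_mul 1 (fun n => (d.hB n _ (d.mem_K h1 h2 n)).2.1) d.Sabs1
  apply le_antisymm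
  · unfold valueFn
    refine iSup₂_le fun Δ hΔ => ?_
    have key : ∀ n, extU U (x + Δ * (S n - 1)) ≤
        ((U (x * S n) + (Δ - x) * (U' (x * S n) * (S n - 1)) : ℝ) : EReal) := by
      intro n
      have h0 : 0 ≤ x + Δ * (S n - 1) := by
        obtain ⟨a1, a2⟩ := hΔ
        have := d.Sabs1 n
        rw [abs_le] at this
        nlinarith
      refine (extU_tangent d.hU' d.hconc h0 (hxS n)).trans (le_of_eq ?_)
      congr 1
      ring
    refine (expE_mono P key).trans ?_
    have i3 : Integrable (fun n => U (x * S n) + (Δ - x) * (U' (x * S n) * (S n - 1))) P :=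
      i1.add (i2.const_mul _)
    rw [expE_real P i3]
    rw [integral_add i1 (i2.const_mul _), integral_const_mul]
    have : (Δ - x) * ∫ n, U' (x * S n) * (S n - 1) ∂P ≤ 0 :=
      mul_nonpos_of_nonpos_of_nonneg (by linarith [hΔ.2]) hg
    exact_mod_cast (by linarith)
  · unfold valueFn
    refine le_trans ?_ (le_iSup₂ x (by constructor <;> linarith))
    have : ∀ n, extU U (x + x * (S n - 1)) = ((U (x * S n) : ℝ) : EReal) := fun n => by
      rw [show x + x * (S n - 1) = x * S n by ring, extU_pos U (hxS n)]
    simp only [this]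
    rw [expE_real P i1]

/-- a feasible strategy gives a lower bound -/
lemma lower (d : Dat U U' U'' P S B x₀) {x Δ : ℝ} (hΔ : Δ ∈ Set.Icc (-x) x)
    (hK : ∀ n, x + Δ * (S n - 1) ∈ Set.Icc (x₀ * S n / 2) (4 * x₀)) :
    ((∫ n, U (x + Δ * (S n - 1)) ∂P : ℝ) : EReal) ≤ valueFn P U S x := by
  unfold valueFn
  refine le_trans ?_ (le_iSup₂ Δ hΔ)
  have : ∀ n, extU U (x + Δ * (S n - 1)) = ((U (x + Δ * (S n - 1)) : ℝ) : EReal) := fun n =>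
    extU_pos U ((d.lo_pos n).trans_le (hK n).1)
  simp only [this]
  rw [expE_real P (d.int_one fun n => (d.hB n _ (hK n)).1)]

lemma hasDerivAt_g (d : Dat U U' U'' P S B x₀) :
    HasDerivAt (fun x => ∫ n, U' (x * S n) * (S n - 1) ∂P)
      (∫ n, U'' (x₀ * S n) * (S n * (S n - 1)) ∂P) x₀ := by
  have hx := d.hx₀
  have hs : Set.Icc (x₀ / 2) (2 * x₀) ∈ 𝓝 x₀ := Icc_mem_nhds (by linarith) (by linarith)
  refine (hasDerivAt_integral_of_dominated_loc_of_deriv_le (μ := P)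
    (F := fun x n => U' (x * S n) * (S n - 1))
    (F' := fun x n => U'' (x * S n) * (S n * (S n - 1))) (bound := fun n => 2 * B n) hs
    (Eventually.of_forall fun x => (Measurable.of_discrete).aestronglyMeasurable) ?_
    (Measurable.of_discrete).aestronglyMeasurable ?_ (d.hBi.const_mul 2) ?_).2
  · exact d.int_mul 1 (fun n => (d.hB n _ (d.mem_K0 n)).2.1) d.Sabs1
  · refine Eventually.of_forall fun n x hx' => ?_
    have e1 := (d.hB n _ (d.mem_K hx'.1 hx'.2 n)).2.2
    rw [Real.norm_eq_abs, abs_mul, abs_mul, mul_comm]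
    have e2 := d.Sabs n
    have e3 := d.Sabs1 n
    have : |S n| * |S n - 1| ≤ 2 * 1 := mul_le_mul e2 e3 (abs_nonneg _) (by norm_num)
    refine mul_le_mul (by linarith) e1 (abs_nonneg _) (by norm_num)
  · refine Eventually.of_forall fun n x hx' => ?_
    have hpos : 0 < x * S n := mul_pos (by linarith [hx'.1]) (d.Spos n)
    have := ((d.hU'' _ hpos).comp x ((hasDerivAt_id x).mul_const (S n))).mul_const (S n - 1)
    simpa [Function.comp_def, mul_assoc] using this

/-- second order expansion of expected utility along a direction `b` -/
lemma expansion (d : Dat U U' U'' P S B x₀) (b : ℕ → ℝ) (C : ℝ) (hb : ∀ n, |b n| ≤ C)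
    (l : Filter ℝ) [l.IsCountablyGenerated] (hl : l ≤ 𝓝[≠] 0)
    (hK : ∀ᶠ h in l, ∀ n, x₀ * S n + h * b n ∈ Set.Icc (x₀ * S n / 2) (4 * x₀)) :
    Tendsto (fun h => (∫ n, U (x₀ * S n + h * b n) ∂P - ∫ n, U (x₀ * S n) ∂P
      - h * ∫ n, U' (x₀ * S n) * b n ∂P) / h ^ 2) l
      (𝓝 (∫ n, U'' (x₀ * S n) * (b n) ^ 2 / 2 ∂P)) := by
  have i0 : Integrable (fun n => U (x₀ * S n)) P :=
    d.int_one fun n => (d.hB n _ (d.mem_K0 n)).1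
  have i1 : Integrable (fun n => U' (x₀ * S n) * b n) P :=
    d.int_mul C (fun n => (d.hB n _ (d.mem_K0 n)).2.1) hb
  have hT : Tendsto (fun h => ∫ n, (U (x₀ * S n + h * b n) - U (x₀ * S n)
      - h * (U' (x₀ * S n) * b n)) / h ^ 2 ∂P) l
      (𝓝 (∫ n, U'' (x₀ * S n) * (b n) ^ 2 / 2 ∂P)) := by
    refine tendsto_integral_filter_of_dominated_convergence (fun n => C ^ 2 * B n)
      (Eventually.of_forall fun h => (Measurable.of_discrete).aestronglyMeasurable) ?_
      (d.hBi.const_mul _) ?_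
    · filter_upwards [hK, hl self_mem_nhdsWithin] with h hh h0
      have h0' : h ≠ 0 := h0
      refine Eventually.of_forall fun n => ?_
      have := taylor_bound d.hU' d.hU'' (d.lo_pos n) (fun z hz => (d.hB n z hz).2.2)
        (d.mem_K0 n) (hh n)
      rw [Real.norm_eq_abs, abs_div, abs_of_pos (by positivity : 0 < h ^ 2),
        div_le_iff₀ (by positivity)]
      have hB0 : 0 ≤ B n := (abs_nonneg _).trans (d.hB n _ (d.mem_K0 n)).1
      have hbb : b n ^ 2 ≤ C ^ 2 := sq_le_sq' (abs_le.1 (hb n)).1 (abs_le.1 (hb n)).2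
      calc _ = |U (x₀ * S n + h * b n) - U (x₀ * S n) - h * b n * U' (x₀ * S n)| := by
            congr 1; ring
        _ ≤ _ := this
        _ = (B n * h ^ 2) * b n ^ 2 := by ring
        _ ≤ (B n * h ^ 2) * C ^ 2 := by gcongr
        _ = _ := by ring
    · refine Eventually.of_forall fun n => ?_
      have hp : 0 < x₀ * S n := mul_pos d.hx₀ (d.Spos n)
      have hlin : ∀ h : ℝ, HasDerivAt (fun h => x₀ * S n + h * b n) (b n) h := fun h => by
        simpa using ((hasDerivAt_id h).mul_const (b n)).const_add (x₀ * S n)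
      have hev : ∀ᶠ h in 𝓝 (0:ℝ), 0 < x₀ * S n + h * b n := by
        have := (hlin 0).continuousAt.eventually (lt_mem_nhds (a := 0) (by simpa using hp))
        simpa using this
      have := peano2 (f := fun h => U (x₀ * S n + h * b n))
        (f' := fun h => U' (x₀ * S n + h * b n) * b n) (c := U'' (x₀ * S n) * b n * b n)
        (by
          filter_upwards [hev] with h hh
          exact (d.hU' _ hh).comp h (hlin h))
        (by
          have h2 := d.hU'' _ hp
          have h3 : HasDerivAt U' (U'' (x₀ * S n)) (x₀ * S n + 0 * b n) := by simpa using h2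
          exact (h3.comp 0 (hlin 0)).mul_const (b n))
      simp only [zero_mul, add_zero] at this
      rw [show U'' (x₀ * S n) * b n ^ 2 / 2 = U'' (x₀ * S n) * b n * b n / 2 by ring]
      exact this.mono_left hl
  refine hT.congr' ?_
  filter_upwards [hK] with h hh
  have i2 : Integrable (fun n => U (x₀ * S n + h * b n)) P :=
    d.int_one fun n => (d.hB n _ (hh n)).1
  have i3 : Integrable (fun n => U (x₀ * S n + h * b n) - U (x₀ * S n)) P := i2.sub i0
  rw [integral_div, integral_sub i3 (i1.const_mul h), integral_sub i2 i0,
    integral_const_mul]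

lemma not_twice (d : Dat U U' U'' P S B x₀)
    (hg0 : ∫ n, U' (x₀ * S n) * (S n - 1) ∂P = 0)
    (hγ : ∫ n, U'' (x₀ * S n) * (S n * (S n - 1)) ∂P ≠ 0)
    (htop : ∀ x > (0:ℝ), valueFn P U S x ≠ ⊤) :
    ¬ ∃ w : ℝ → ℝ,
          (∀ x > (0:ℝ), HasDerivAt (fun t => (valueFn P U S t).toReal) (w x) x) ∧
          DifferentiableAt ℝ w x₀ := by
  rintro ⟨w, hw, hwd⟩
  have hx := d.hx₀
  have hder := d.hasDerivAt_g
  set γ := ∫ n, U'' (x₀ * S n) * (S n * (S n - 1)) ∂P with hγdef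
  set R := ∫ n, U'' (x₀ * S n) * (S n - 1) ^ 2 ∂P with hR
  set u : ℝ → ℝ := fun t => (valueFn P U S t).toReal with hu
  have hγ2 : 0 < γ ^ 2 := by positivity
  obtain ⟨s, hs1, hsγ, hspos⟩ : ∃ s : ℝ, |s| ≤ 1 ∧ 0 < s * γ ∧ 0 < s * γ + s ^ 2 * R / 2 := by
    have hp : 0 < 1 + |γ| + |R| := by positivity
    set t := 1 / (1 + |γ| + |R|) with ht
    have htp : 0 < t := by positivity
    have ht1 : t * (1 + |γ| + |R|) = 1 := by rw [ht]; field_simp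
    have hR1 := neg_abs_le R
    have htR : 0 ≤ t * |R| := by positivity
    have htg : 0 ≤ t * |γ| := by positivity
    refine ⟨γ * t, ?_, ?_, ?_⟩
    · rw [abs_mul, abs_of_pos htp]; nlinarith
    · have : 0 < γ ^ 2 * t := by positivity
      nlinarith
    · have h1 : 0 < 1 + t * R / 2 := by nlinarith
      have h2 : 0 < γ ^ 2 * t * (1 + t * R / 2) := by positivity
      nlinarith
  set l1 : Filter ℝ := 𝓝[{h | 0 < h * γ}] 0 with hl1
  set l2 : Filter ℝ := 𝓝[{h | h * γ < 0}] 0 with hl2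
  have l1le : l1 ≤ 𝓝[≠] 0 := nhdsWithin_mono _ fun h hh => by
    rintro rfl; simp at hh
  have l2le : l2 ≤ 𝓝[≠] 0 := nhdsWithin_mono _ fun h hh => by
    rintro rfl; simp at hh
  have ne1 : l1.NeBot := by
    rcases lt_or_gt_of_ne hγ with h | h
    · have : {h | 0 < h * γ} = Set.Iio 0 := by
        ext t; simp only [mem_ofPred_eq, mem_Iio]; constructor <;> intro <;> nlinarith
      rw [hl1, this]; infer_instance
    · have : {h | 0 < h * γ} = Set.Ioi 0 := by
        ext t; simp only [mem_ofPred_eq, mem_Ioi]; constructor <;> intro <;> nlinarith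
      rw [hl1, this]; infer_instance
  have ne2 : l2.NeBot := by
    rcases lt_or_gt_of_ne hγ with h | h
    · have : {h | h * γ < 0} = Set.Ioi 0 := by
        ext t; simp only [mem_ofPred_eq, mem_Ioi]; constructor <;> intro <;> nlinarith
      rw [hl2, this]; infer_instance
    · have : {h | h * γ < 0} = Set.Iio 0 := by
        ext t; simp only [mem_ofPred_eq, mem_Iio]; constructor <;> intro <;> nlinarith
      rw [hl2, this]; infer_instance
  have small : ∀ᶠ h in 𝓝 (0:ℝ), |h| ≤ x₀ / 4 := by
    have : Set.Icc (-(x₀ / 4)) (x₀ / 4) ∈ 𝓝 (0:ℝ) := Icc_mem_nhds (by linarith) (by linarith)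
    filter_upwards [this] with h hh
    exact abs_le.2 hh
  have small1 : ∀ᶠ h in l1, |h| ≤ x₀ / 4 := l1le (nhdsWithin_le_nhds small)
  have small2 : ∀ᶠ h in l2, |h| ≤ x₀ / 4 := l2le (nhdsWithin_le_nhds small)
  have hgpos : ∀ᶠ h in l1, 0 ≤ ∫ n, U' ((x₀ + h) * S n) * (S n - 1) ∂P := by
    have h1 := (hasDerivAt_iff_tendsto_slope_zero.1 hder).mul_const γ
    have h2 := h1.eventually (lt_mem_nhds (by nlinarith : 0 < γ * γ))
    filter_upwards [l1le h2, self_mem_nhdsWithin] with h h3 h4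
    simp only [smul_eq_mul, hg0, sub_zero] at h3
    have h4' : 0 < h * γ := h4
    have hne : h ≠ 0 := by rintro rfl; simp at h4'
    have h5 : 0 < (h⁻¹ * (∫ n, U' ((x₀ + h) * S n) * (S n - 1) ∂P) * γ) * h ^ 2 := by
      positivity
    have h6 : (h⁻¹ * (∫ n, U' ((x₀ + h) * S n) * (S n - 1) ∂P) * γ) * h ^ 2 =
      (h * γ) * (∫ n, U' ((x₀ + h) * S n) * (S n - 1) ∂P) := by field_simp
    rw [h6] at h5
    exact (pos_of_mul_pos_right h5 h4'.le).le
  have hu0 : u x₀ = ∫ n, U (x₀ * S n) ∂P := by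
    simp only [hu]
    rw [d.binding (by linarith) (by linarith) hg0.ge, EReal.toReal_coe]
  have hu1 : ∀ᶠ h in l1, u (x₀ + h) = ∫ n, U (x₀ * S n + h * S n) ∂P := by
    filter_upwards [small1, hgpos] with h h1 h2
    rw [abs_le] at h1
    simp only [hu]
    rw [d.binding (by linarith) (by linarith) h2, EReal.toReal_coe]
    simp only [add_mul]
  have T : Tendsto (fun h => (u (x₀ + h) - u x₀ - h * w x₀) / h ^ 2) (𝓝[≠] 0)
      (𝓝 (deriv w x₀ / 2)) := by
    have hlin : ∀ h : ℝ, HasDerivAt (fun h => x₀ + h) 1 h := fun h =>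
      (hasDerivAt_id h).const_add x₀
    have := peano2 (f := fun h => u (x₀ + h)) (f' := fun h => w (x₀ + h)) (c := deriv w x₀)
      (by
        filter_upwards [small] with h hh
        rw [abs_le] at hh
        have := (hw (x₀ + h) (by linarith)).comp h (hlin h)
        simpa [Function.comp_def] using this)
      (by
        have h3 : HasDerivAt w (deriv w x₀) (x₀ + 0) := by simpa using hwd.hasDerivAt
        simpa [Function.comp_def] using h3.comp 0 (hlin 0))
    simpa using this
  have E1 := d.expansion S 2 d.Sabs l1 l1le (by
    filter_upwards [small1] with h hh n
    rw [abs_le] at hh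
    have := d.mem_K (x := x₀ + h) (by linarith) (by linarith) n
    rwa [add_mul] at this)
  set m := ∫ n, U' (x₀ * S n) * S n ∂P with hm
  have E1' : Tendsto (fun h => (u (x₀ + h) - u x₀ - h * m) / h ^ 2) l1
      (𝓝 (∫ n, U'' (x₀ * S n) * S n ^ 2 / 2 ∂P)) := by
    refine E1.congr' ?_
    filter_upwards [hu1] with h hh
    rw [hh, hu0]
  have hwm : w x₀ = m := by
    have h1 := (E1'.sub (T.mono_left l1le)).mul
      ((tendsto_id (α := ℝ) (x := 𝓝 0)).mono_left (l1le.trans nhdsWithin_le_nhds))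
    rw [mul_zero] at h1
    have h2 : Tendsto (fun _ : ℝ => w x₀ - m) l1 (𝓝 0) := by
      refine h1.congr' ?_
      filter_upwards [l1le self_mem_nhdsWithin] with h hh
      have : h ≠ 0 := hh
      simp only [id]
      field_simp
      ring
    have := tendsto_nhds_unique h2 tendsto_const_nhds
    linarith
  have hQ1 : deriv w x₀ / 2 = ∫ n, U'' (x₀ * S n) * S n ^ 2 / 2 ∂P := by
    rw [hwm] at T
    exact tendsto_nhds_unique (T.mono_left l1le) E1'
  have hbb : ∀ n, |S n + s * (S n - 1)| ≤ 3 := fun n => by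
    have h1 := d.Sabs n
    have h2 := d.Sabs1 n
    have h3 : |s * (S n - 1)| ≤ 1 := by
      rw [abs_mul]; nlinarith [abs_nonneg s, abs_nonneg (S n - 1)]
    linarith [abs_add_le (S n) (s * (S n - 1))]
  have hK : ∀ᶠ h in l2, h * s ≤ 0 ∧ ∀ n, x₀ * S n + h * (S n + s * (S n - 1)) ∈
      Set.Icc (x₀ * S n / 2) (4 * x₀) := by
    filter_upwards [small2, self_mem_nhdsWithin] with h h1 h2
    have h2' : h * γ < 0 := h2
    have hhs : h * s ≤ 0 := by
      by_contra! hc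
      have : 0 < (h * s) * (s * γ) := mul_pos hc hsγ
      have h5 : (h * s) * (s * γ) = s ^ 2 * (h * γ) := by ring
      nlinarith [sq_nonneg s]
    refine ⟨hhs, fun n => ?_⟩
    have hprod : |h * (S n + s * (S n - 1))| ≤ x₀ / 4 * 3 := by
      rw [abs_mul]; exact mul_le_mul h1 (hbb n) (abs_nonneg _) (by linarith)
    rw [abs_le] at hprod h1
    rcases d.hS n with h3 | ⟨h3, h4⟩
    · constructor
      · rw [h3] at hprod ⊢; linarith
      · rw [h3] at hprod ⊢; linarith
    · constructor
      · have : 0 ≤ (h * s) * (S n - 1) := mul_nonneg_of_nonpos_of_nonpos hhs (by linarith)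
        nlinarith
      · nlinarith
  have E2 := d.expansion (fun n => S n + s * (S n - 1)) 3 hbb l2 l2le (hK.mono fun h hh => hh.2)
  have jS : Integrable (fun n => U' (x₀ * S n) * S n) P :=
    d.int_mul 2 (fun n => (d.hB n _ (d.mem_K0 n)).2.1) d.Sabs
  have jS1 : Integrable (fun n => U' (x₀ * S n) * (S n - 1)) P :=
    d.int_mul 1 (fun n => (d.hB n _ (d.mem_K0 n)).2.1) d.Sabs1
  have hm2 : ∫ n, U' (x₀ * S n) * (S n + s * (S n - 1)) ∂P = m := by
    have : ∀ n, U' (x₀ * S n) * (S n + s * (S n - 1)) =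
        U' (x₀ * S n) * S n + s * (U' (x₀ * S n) * (S n - 1)) := fun n => by ring
    simp only [this]
    rw [integral_add jS (jS1.const_mul s), integral_const_mul, hg0]
    simp [hm]
  have hU2 : ∀ n, |U'' (x₀ * S n)| ≤ B n := fun n => (d.hB n _ (d.mem_K0 n)).2.2
  have k1 : Integrable (fun n => U'' (x₀ * S n) * S n ^ 2 / 2) P := by
    refine (d.int_mul 4 hU2 (b := fun n => S n ^ 2) fun n => ?_).div_const 2
    rw [abs_of_nonneg (sq_nonneg _)]
    nlinarith [d.Spos n, d.Sle n]
  have k2 : Integrable (fun n => U'' (x₀ * S n) * (S n * (S n - 1))) P := by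
    refine d.int_mul 2 hU2 fun n => ?_
    rw [abs_mul]
    nlinarith [d.Sabs n, d.Sabs1 n, abs_nonneg (S n), abs_nonneg (S n - 1)]
  have k3 : Integrable (fun n => U'' (x₀ * S n) * (S n - 1) ^ 2) P := by
    refine d.int_mul 1 hU2 (b := fun n => (S n - 1) ^ 2) fun n => ?_
    rw [abs_of_nonneg (sq_nonneg _)]
    nlinarith [d.Spos n, d.Sle n]
  have hQ2 : ∫ n, U'' (x₀ * S n) * (S n + s * (S n - 1)) ^ 2 / 2 ∂P =
      ∫ n, U'' (x₀ * S n) * S n ^ 2 / 2 ∂P + (s * γ + s ^ 2 / 2 * R) := by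
    have : ∀ n, U'' (x₀ * S n) * (S n + s * (S n - 1)) ^ 2 / 2 =
        U'' (x₀ * S n) * S n ^ 2 / 2 + (s * (U'' (x₀ * S n) * (S n * (S n - 1)))
          + s ^ 2 / 2 * (U'' (x₀ * S n) * (S n - 1) ^ 2)) := fun n => by ring
    simp only [this]
    have k4 : Integrable (fun n => s * (U'' (x₀ * S n) * (S n * (S n - 1)))
          + s ^ 2 / 2 * (U'' (x₀ * S n) * (S n - 1) ^ 2)) P :=
      (k2.const_mul _).add (k3.const_mul _)
    rw [integral_add k1 k4, integral_add (k2.const_mul _) (k3.const_mul _), integral_const_mul,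
      integral_const_mul]
  have hle : ∫ n, U'' (x₀ * S n) * (S n + s * (S n - 1)) ^ 2 / 2 ∂P ≤ deriv w x₀ / 2 := by
    refine le_of_tendsto_of_tendsto E2 (T.mono_left l2le) ?_
    filter_upwards [hK, small2] with h hh h1
    obtain ⟨hhs, hKn⟩ := hh
    rw [hm2, hwm, hu0]
    rw [abs_le] at h1
    have hhs2 : |h * s| ≤ x₀ / 4 := by
      rw [abs_mul]
      have := abs_le.2 h1
      nlinarith [abs_nonneg h, abs_nonneg s]
    rw [abs_le] at hhs2
    have hwealth : ∀ n, (x₀ + h) + (x₀ + h + h * s) * (S n - 1) =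
        x₀ * S n + h * (S n + s * (S n - 1)) := fun n => by ring
    have hlow := d.lower (x := x₀ + h) (Δ := x₀ + h + h * s)
      ⟨by linarith, by linarith⟩ (fun n => by rw [hwealth]; exact hKn n)
    simp only [hwealth] at hlow
    have hlow' : ∫ n, U (x₀ * S n + h * (S n + s * (S n - 1))) ∂P ≤ u (x₀ + h) := by
      simp only [hu]
      rw [← EReal.toReal_coe (∫ n, U (x₀ * S n + h * (S n + s * (S n - 1))) ∂P)]
      exact EReal.toReal_le_toReal hlow (EReal.coe_ne_bot _) (htop _ (by linarith))
    gcongr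
  rw [hQ2, hQ1] at hle
  linarith

end Dat
/-- Counterexample 2.  Let `U : (0,∞) → ℝ` be strictly increasing,
strictly concave, twice continuously differentiable, satisfy the Inada conditions, and
have non-constant relative risk aversion `A(x) = −x U''(x)/U'(x)`.  Then there exist a
probability space and a stock `S` taking each value in `{2} ∪ {1/m : m ≥ 1}` with
positive probability, such that the value function `u(x) = sup_{Δ∈[−x,x]} E[U(x+Δ(S−1))]`
(with the convention `E[U(X)] = −∞` whenever `E[U⁻(X)] = ∞`) is finite for every `x > 0`
but fails to be twice differentiable at some `x₀ > 0`. -/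
theorem stmt16 (U U' U'' : ℝ → ℝ)
    (hU' : ∀ x > (0:ℝ), HasDerivAt U (U' x) x)
    (hU'' : ∀ x > (0:ℝ), HasDerivAt U' (U'' x) x)
    (hU''c : ContinuousOn U'' (Set.Ioi 0))
    (hmono : StrictMonoOn U (Set.Ioi 0))
    (hconc : StrictConcaveOn ℝ (Set.Ioi 0) U)
    (hInada0 : Filter.Tendsto U' (nhdsWithin 0 (Set.Ioi 0)) Filter.atTop)
    (hInadaInf : Filter.Tendsto U' Filter.atTop (nhds 0))
    (hA : ∃ x > (0:ℝ), ∃ y > (0:ℝ), -(x * U'' x) / U' x ≠ -(y * U'' y) / U' y) :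
    ∃ (Ω : Type) (_ : MeasurableSpace Ω) (P : Measure Ω) (S : Ω → ℝ),
      IsProbabilityMeasure P ∧ Measurable S ∧
      (∀ ω, S ω = 2 ∨ ∃ m : ℕ, 1 ≤ m ∧ S ω = 1 / (m : ℝ)) ∧
      0 < P {ω | S ω = 2} ∧
      (∀ m : ℕ, 1 ≤ m → 0 < P {ω | S ω = 1 / (m : ℝ)}) ∧
      (∀ x > (0:ℝ), valueFn P U S x ≠ ⊥ ∧ valueFn P U S x ≠ ⊤) ∧
      ∃ x₀ > (0:ℝ),
        ¬ ∃ w : ℝ → ℝ,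
          (∀ x > (0:ℝ), HasDerivAt (fun t => (valueFn P U S t).toReal) (w x) x) ∧
          DifferentiableAt ℝ w x₀ := by
  classical
  have hcc := hconc.concaveOn
  have hpos : ∀ y > (0:ℝ), 0 < U' y := fun y hy => deriv_pos_of hU' hmono hcc hy
  have hU'c : ContinuousOn U' (Set.Ioi 0) := fun x hx =>
    (hU'' x hx).continuousAt.continuousWithinAt
  have hUc : ContinuousOn U (Set.Ioi 0) := fun x hx =>
    (hU' x hx).continuousAt.continuousWithinAt
  obtain ⟨x₀, hx₀, n₀, hn₀, hne⟩ := exists_ne_dilate (fun x => -(x * U'' x) / U' x)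
    ((continuousOn_id.mul hU''c).neg.div hU'c fun x hx => (hpos x hx).ne') hA
  set S : ℕ → ℝ := fun n => if n = 0 then 2 else 1 / (n : ℝ) with hSdef
  have S0 : S 0 = 2 := by simp [hSdef]
  have Sn : ∀ n : ℕ, 1 ≤ n → S n = 1 / (n : ℝ) := fun n hn => by
    simp only [hSdef]; rw [if_neg (by omega)]
  have hS : ∀ n, S n = 2 ∨ (0 < S n ∧ S n ≤ 1) := by
    intro n
    rcases Nat.eq_zero_or_pos n with h | h
    · left; rw [h, S0]
    · right
      rw [Sn n h]
      have h1 : (1:ℝ) ≤ n := by exact_mod_cast h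
      exact ⟨by positivity, by rw [div_le_one (by linarith)]; exact h1⟩
  have Spos : ∀ n, 0 < S n := fun n => by
    rcases hS n with h | h
    · rw [h]; norm_num
    · exact h.1
  have Sle : ∀ n, S n ≤ 2 := fun n => by
    rcases hS n with h | h
    · rw [h]
    · linarith [h.2]
  have hBex : ∀ n, ∃ M : ℝ, 1 ≤ M ∧ ∀ z ∈ Set.Icc (x₀ * S n / 2) (4 * x₀),
      |U z| ≤ M ∧ |U' z| ≤ M ∧ |U'' z| ≤ M := by
    intro n
    have hlo : 0 < x₀ * S n / 2 := by have := Spos n; positivity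
    have hsub : Set.Icc (x₀ * S n / 2) (4 * x₀) ⊆ Set.Ioi 0 := fun z hz => hlo.trans_le hz.1
    obtain ⟨C1, h1⟩ := isCompact_Icc.exists_bound_of_continuousOn (hUc.mono hsub)
    obtain ⟨C2, h2⟩ := isCompact_Icc.exists_bound_of_continuousOn (hU'c.mono hsub)
    obtain ⟨C3, h3⟩ := isCompact_Icc.exists_bound_of_continuousOn (hU''c.mono hsub)
    refine ⟨1 + |C1| + |C2| + |C3|, ?_, fun z hz => ?_⟩
    · linarith [abs_nonneg C1, abs_nonneg C2, abs_nonneg C3]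
    · have e1 := h1 z hz
      have e2 := h2 z hz
      have e3 := h3 z hz
      rw [Real.norm_eq_abs] at e1 e2 e3
      refine ⟨?_, ?_, ?_⟩ <;> linarith [abs_nonneg C1, abs_nonneg C2, abs_nonneg C3,
        le_abs_self C1, le_abs_self C2, le_abs_self C3]
  choose B hB1 hB using hBex
  have hmem : ∀ n, x₀ * S n ∈ Set.Icc (x₀ * S n / 2) (4 * x₀) := fun n => by
    have := Spos n
    have := Sle n
    constructor <;> nlinarith
  have S1 : ∀ n, |S n - 1| ≤ 1 := fun n => by
    rw [abs_le]; constructor <;> linarith [Spos n, Sle n]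
  have S2 : ∀ n, |S n| ≤ 2 := fun n => by
    rw [abs_of_pos (Spos n)]; exact Sle n
  have hn₀' : (2:ℝ) ≤ n₀ := by exact_mod_cast hn₀
  have hn₀p : (0:ℝ) < n₀ := by linarith
  have Sn₀ := Sn n₀ (by omega)
  have hSn₀lt : S n₀ < 1 := by rw [Sn₀, div_lt_one hn₀p]; linarith
  obtain ⟨p, ppos, psum, pB, pa, pb⟩ := weights (fun n => U' (x₀ * S n) * (S n - 1))
    (fun n => U'' (x₀ * S n) * (S n * (S n - 1))) (fun n => 2 * B n) n₀
    (fun n => by linarith [hB1 n])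
    (fun n => by
      have := (hB n _ (hmem n)).2.1
      rw [abs_mul]
      nlinarith [S1 n, abs_nonneg (S n - 1), abs_nonneg (U' (x₀ * S n)), hB1 n])
    (fun n => by
      have h1 := (hB n _ (hmem n)).2.2
      rw [abs_mul, abs_mul, mul_comm]
      have h2 : |S n| * |S n - 1| ≤ 2 * 1 := mul_le_mul (S2 n) (S1 n) (abs_nonneg _) (by norm_num)
      exact mul_le_mul (by linarith) h1 (abs_nonneg _) (by norm_num))
    (by
      have := hpos (x₀ * S 0) (mul_pos hx₀ (Spos 0))
      rw [S0] at this ⊢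
      linarith)
    (mul_neg_of_pos_of_neg (hpos _ (mul_pos hx₀ (Spos n₀))) (by linarith))
    (by
      intro h
      apply hne
      have e0 := hpos (x₀ * S 0) (mul_pos hx₀ (Spos 0))
      have e1 := hpos (x₀ * S n₀) (mul_pos hx₀ (Spos n₀))
      have q0 : x₀ * S 0 = 2 * x₀ := by rw [S0]; ring
      have q1 : x₀ / n₀ = x₀ * S n₀ := by rw [Sn₀]; ring
      rw [q1, ← q0, div_eq_div_iff e1.ne' e0.ne']
      have h1 : (S n₀ - 1) * (U'' (x₀ * S n₀) * S n₀ * U' (x₀ * S 0) -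
          U'' (x₀ * S 0) * S 0 * U' (x₀ * S n₀)) = 0 := by
        have e5 : S 0 - 1 = 1 := by rw [S0]; norm_num
        simp only [e5] at h
        linear_combination h
      rcases mul_eq_zero.1 h1 with h2 | h2
      · linarith
      · linear_combination (-x₀) * h2)
  set P : Measure ℕ := Measure.sum (fun n => ENNReal.ofReal (p n) • Measure.dirac n) with hP
  have hPs : ∀ n, P {n} = ENNReal.ofReal (p n) := fun n => by
    rw [hP, Measure.sum_smul_dirac_singleton]
  have hPprob : IsProbabilityMeasure P := by
    constructor
    rw [hP, Measure.sum_apply _ MeasurableSet.univ]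
    simp only [Measure.smul_apply, measure_univ, smul_eq_mul, mul_one]
    rw [← ENNReal.ofReal_tsum_of_nonneg (fun n => (ppos n).le) psum.summable, psum.tsum_eq]
    simp
  have hint : ∀ f : ℕ → ℝ, ∫ n, f n ∂P = ∑' n, p n * f n := fun f => by
    rw [hP, integral_sum_dirac (fun _ => ENNReal.ofReal_ne_top)]
    simp [ENNReal.toReal_ofReal (ppos _).le]
  have hBi : Integrable B P := by
    rw [hP]
    apply integrable_sum_dirac (fun _ => ENNReal.ofReal_ne_top)
    have := pB.mul_left (1/2)
    refine this.congr fun n => ?_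
    rw [ENNReal.toReal_ofReal (ppos _).le, Real.norm_eq_abs, abs_of_pos (by linarith [hB1 n])]
    ring
  have hfin : ∀ x > (0:ℝ), valueFn P U S x ≠ ⊥ ∧ valueFn P U S x ≠ ⊤ := fun x hx =>
    value_finite hmono P S hS hx
  have d : Dat U U' U'' P S B x₀ := ⟨hU', hU'', hcc, hS, hx₀, hB, hBi⟩
  have hpt : ∀ (n : ℕ) (c : ℝ), S n = c → 0 < P {m | S m = c} := by
    intro n c hc
    refine lt_of_lt_of_le ?_ (measure_mono (s := {n}) (by simpa using hc))
    rw [hPs]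
    exact ENNReal.ofReal_pos.2 (ppos n)
  refine ⟨ℕ, inferInstance, P, S, hPprob, Measurable.of_discrete, ?_, hpt 0 2 S0,
    fun m hm => hpt m _ (Sn m hm), hfin, x₀, hx₀, ?_⟩
  · intro n
    rcases Nat.eq_zero_or_pos n with h | h
    · left; rw [h, S0]
    · exact Or.inr ⟨n, h, Sn n h⟩
  · exact d.not_twice (by rw [hint]; exact pa) (by rw [hint]; exact pb) fun x hx => (hfin x hx).2
end
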